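/- Suppose N = d(n−d) is even. Then the number of standard Young tableaux of rectangular shape Rect = (n−d)^d fixed by evacuation 𝑒 equals the number of standard Young tableaux of shape Rect fixed by 𝑗^{N/2}, the (N/2)-th power of promotion. -/

import Mathlib

open Polynomial

noncomputable section

/-! ### The Grassmannian `X = Gr(d, ℂ_{n-1}[z])` and the Wronski map -/

/-- The Wronskian determinant of a `d`-tuple of polynomials. -/
def wronskDet (d : ℕ) (f : Fin d → Polynomial ℂ) : Polynomial ℂ :=
  Matrix.det (Matrix.of fun i j : Fin d =>
    (fun p : Polynomial ℂ => Polynomial.derivative p)^[(j : ℕ)] (f i))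

/-- `x` is a point of the Grassmannian `Gr(d, ℂ_{n-1}[z])`. -/
def IsGrPoint (n d : ℕ) (x : Submodule ℂ (Polynomial ℂ)) : Prop :=
  x ≤ Polynomial.degreeLT ℂ n ∧ Module.finrank ℂ x = d

/-- `x` lies in the fibre of the Wronski map over `h` (an element of the
projective space `ℙ(ℂ_N[z])`, i.e. the Wronskian of a basis of `x` is a nonzero
scalar multiple of `h`). -/
def InFibre (d : ℕ) (x : Submodule ℂ (Polynomial ℂ)) (h : Polynomial ℂ) : Prop :=
  ∃ (f : Fin d → Polynomial ℂ) (c : ℂ), c ≠ 0 ∧ LinearIndependent ℂ f ∧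
    Submodule.span ℂ (Set.range f) = x ∧ wronskDet d f = c • h

/-- The linear substitution `f(z) ↦ f(c·z)` on polynomials. -/
def rotMap (c : ℂ) : Polynomial ℂ →ₗ[ℂ] Polynomial ℂ :=
  (Polynomial.aeval (Polynomial.C c * Polynomial.X) :
    Polynomial ℂ →ₐ[ℂ] Polynomial ℂ).toLinearMap

/-- `x` is fixed by the cyclic group `C_r ⊂ PGL₂(ℂ)` of classes of
`diag(e^{πij/r}, e^{-πij/r})`, `j = 0, …, r-1`; the induced (projective) action on
`Gr(d, ℂ_{n-1}[z])` is via the substitutions `z ↦ e^{-2πij/r} z`. -/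
def CrFixed (r : ℕ) (x : Submodule ℂ (Polynomial ℂ)) : Prop :=
  ∀ j : Fin r,
    Submodule.map
      (rotMap (Complex.exp (-(2 * (Real.pi : ℂ) * Complex.I * ((j : ℕ) : ℂ)) / (r : ℂ)))) x = x

/-- The linear map `f(z) ↦ z^{n-1} f(1/z)` on `ℂ_{n-1}[z]`,
realizing the reflection `(0 1; 1 0) ∈ PGL₂(ℂ)`. -/
def reflectMap (n : ℕ) : Polynomial ℂ →ₗ[ℂ] Polynomial ℂ :=
  ∑ k ∈ Finset.range n,
    (Polynomial.lcoeff ℂ k).smulRight ((Polynomial.X : Polynomial ℂ) ^ (n - 1 - k))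

/-- `x` is fixed by the dihedral group `D_r ⊂ PGL₂(ℂ)` generated by `C_r` and the
reflection `z ↦ 1/z`. -/
def DrFixed (n r : ℕ) (x : Submodule ℂ (Polynomial ℂ)) : Prop :=
  CrFixed r x ∧ Submodule.map (reflectMap n) x = x

/-! ### Partitions, Richardson varieties, compatibility -/

/-- A partition with at most `d` parts, each of size at most `w`
(recorded as a function `ℕ → ℕ` vanishing from index `d` on; part `i` (0-based)
is the `(i+1)`-st part). -/
structure PartitionIn (d w : ℕ) where
  part : ℕ → ℕ
  antitone : ∀ ⦃i j : ℕ⦄, i ≤ j → part j ≤ part i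
  le_w : ∀ i, part i ≤ w
  eq_zero : ∀ i, d ≤ i → part i = 0

/-- The size `|λ|` of a partition. -/
def PartitionIn.size {d w : ℕ} (lam : PartitionIn d w) : ℕ :=
  ∑ i ∈ Finset.range d, lam.part i

/-- Containment `μ ⊆ λ` of partitions. -/
def SubPartition {d w : ℕ} (mu lam : PartitionIn d w) : Prop :=
  ∀ i, mu.part i ≤ lam.part i

/-- The full rectangular partition `(w)^d`. -/
def rectPart (d w : ℕ) : PartitionIn d w :=
  { part := fun i => if i < d then w else 0
    antitone := by
      intro i j hij
      by_cases hj : j < d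
      · have hi : i < d := lt_of_le_of_lt hij hj
        simp [hi, hj]
      · simp [hj]
    le_w := by intro i; by_cases hi : i < d <;> simp [hi]
    eq_zero := by intro i hi; simp [Nat.not_lt.mpr hi] }

/-- The empty partition. -/
def zeroPart (d w : ℕ) : PartitionIn d w :=
  { part := fun _ => 0
    antitone := by intro i j _; exact le_rfl
    le_w := fun _ => Nat.zero_le _
    eq_zero := fun _ _ => rfl }

/-- The flag `F_i = z^{n-i} ℂ_{i-1}[z]` inside `ℂ_{n-1}[z]`. -/
def Fflag (n i : ℕ) : Submodule ℂ (Polynomial ℂ) :=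
  Polynomial.degreeLT ℂ n ⊓
    Submodule.restrictScalars ℂ (Ideal.span {(Polynomial.X : Polynomial ℂ) ^ (n - i)})

/-- The flag `F̃_i = ℂ_{i-1}[z]`. -/
def Ftilde (i : ℕ) : Submodule ℂ (Polynomial ℂ) := Polynomial.degreeLT ℂ i

/-- Membership in the Richardson variety `X_{λ/μ}`. -/
def InRichardson (n d : ℕ) (lam mu : PartitionIn d (n - d))
    (x : Submodule ℂ (Polynomial ℂ)) : Prop :=
  ∀ i : ℕ, i < d →
    i + 1 ≤ Module.finrank ℂ ↥(x ⊓ Fflag n (n - d - mu.part i + (i + 1))) ∧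
    i + 1 ≤ Module.finrank ℂ ↥(x ⊓ Ftilde (lam.part (d - 1 - i) + (i + 1)))

/-- The Richardson variety `X_{λ/μ}` is compatible with the polynomial `h`:
`μ ⊆ λ`, `|λ| = deg h` and `|μ| = mindeg h`. -/
def Compatible (n d : ℕ) (lam mu : PartitionIn d (n - d)) (h : Polynomial ℂ) : Prop :=
  SubPartition mu lam ∧ lam.size = h.natDegree ∧ mu.size = h.rootMultiplicity 0

/-! ### Ribbons and tableaux -/

/-- Two boxes (row, column) are adjacent. -/
def BoxAdj (p q : ℕ × ℕ) : Prop :=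
  (p.1 = q.1 ∧ (p.2 + 1 = q.2 ∨ q.2 + 1 = p.2)) ∨
  (p.2 = q.2 ∧ (p.1 + 1 = q.1 ∨ q.1 + 1 = p.1))

/-- A set of boxes is an `r`-ribbon: it has `r` boxes, is connected,
and contains no 2×2 square. -/
def IsRibbon (r : ℕ) (S : Set (ℕ × ℕ)) : Prop :=
  S.ncard = r ∧
  (∀ p ∈ S, ∀ q ∈ S, Relation.ReflTransGen (fun u v => u ∈ S ∧ v ∈ S ∧ BoxAdj u v) p q) ∧
  ¬ ∃ i j : ℕ, (i, j) ∈ S ∧ (i + 1, j) ∈ S ∧ (i, j + 1) ∈ S ∧ (i + 1, j + 1) ∈ S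

/-- The box `(i,j)` (0-based row and column) lies in the skew diagram `λ/μ`. -/
def InShape {d w : ℕ} (lam mu : PartitionIn d w) (i j : ℕ) : Prop :=
  i < d ∧ mu.part i ≤ j ∧ j < lam.part i

/-- `E` is a standard `r`-ribbon tableau of skew shape `λ/μ` with entries `1, …, ℓ`
(recorded as a function on boxes, normalized to `0` off the shape). -/
def IsSRT {d w : ℕ} (r ℓ : ℕ) (lam mu : PartitionIn d w) (E : ℕ → ℕ → ℕ) : Prop :=
  (∀ i j, ¬ InShape lam mu i j → E i j = 0) ∧
  (∀ i j, InShape lam mu i j → 1 ≤ E i j ∧ E i j ≤ ℓ) ∧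
  (∀ i j j', InShape lam mu i j → InShape lam mu i j' → j ≤ j' → E i j ≤ E i j') ∧
  (∀ i i' j, InShape lam mu i j → InShape lam mu i' j → i ≤ i' → E i j ≤ E i' j) ∧
  (∀ k, 1 ≤ k → k ≤ ℓ → IsRibbon r {p : ℕ × ℕ | InShape lam mu p.1 p.2 ∧ E p.1 p.2 = k})

/-- A tableau (with boxes inside the `d × w` rectangle and largest entry `m`) is
rotationally invariant: it is fixed by rotating `180°` inside the rectangle and
replacing each entry `k` by `m + 1 - k`. -/
def RotInvariant {d w : ℕ} (m : ℕ) (lam mu : PartitionIn d w) (E : ℕ → ℕ → ℕ) : Prop :=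
  ∀ i j, InShape lam mu i j →
    InShape lam mu (d - 1 - i) (w - 1 - j) ∧
    E (d - 1 - i) (w - 1 - j) = m + 1 - E i j

/-- For `ℓ` even: a tableau of shape `λ/μ` with entries `1, …, ℓ-1`, in which the
boxes with entry `k ≠ ℓ/2` form `r`-ribbons and the boxes with entry `ℓ/2`
form a `2r`-ribbon. -/
def IsHatSRT {d w : ℕ} (r ℓ : ℕ) (lam mu : PartitionIn d w) (E : ℕ → ℕ → ℕ) : Prop :=
  (∀ i j, ¬ InShape lam mu i j → E i j = 0) ∧
  (∀ i j, InShape lam mu i j → 1 ≤ E i j ∧ E i j ≤ ℓ - 1) ∧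
  (∀ i j j', InShape lam mu i j → InShape lam mu i j' → j ≤ j' → E i j ≤ E i j') ∧
  (∀ i i' j, InShape lam mu i j → InShape lam mu i' j → i ≤ i' → E i j ≤ E i' j) ∧
  (∀ k, 1 ≤ k → k ≤ ℓ - 1 → k ≠ ℓ / 2 →
    IsRibbon r {p : ℕ × ℕ | InShape lam mu p.1 p.2 ∧ E p.1 p.2 = k}) ∧
  IsRibbon (2 * r) {p : ℕ × ℕ | InShape lam mu p.1 p.2 ∧ E p.1 p.2 = ℓ / 2}

/-! ### Rectangular standard Young tableaux, promotion and evacuation -/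

/-- `E` is a standard Young tableau of rectangular shape `d × w`
(normalized to `0` outside the rectangle). -/
def IsSYT (d w : ℕ) (E : ℕ → ℕ → ℕ) : Prop :=
  (∀ i j, d ≤ i ∨ w ≤ j → E i j = 0) ∧
  (∀ i j, i < d → j < w → 1 ≤ E i j ∧ E i j ≤ d * w) ∧
  (∀ i j, i < d → j + 1 < w → E i j < E i (j + 1)) ∧
  (∀ i j, i + 1 < d → j < w → E i j < E (i + 1) j) ∧
  (∀ m, 1 ≤ m → m ≤ d * w → ∃ i j, i < d ∧ j < w ∧ E i j = m)

/-- One step of the jeu de taquin slide of the empty box, restricted to the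
subtableau of entries `≤ i₀`: the empty box swaps with the smaller of its east
and south neighbours (among entries `≤ i₀`), if any. -/
def slideStep (d w i₀ : ℕ) (E : ℕ → ℕ → ℕ) (p : ℕ × ℕ) : ℕ × ℕ :=
  if (p.1 + 1 < d ∧ E (p.1 + 1) p.2 ≤ i₀) ∧ (p.2 + 1 < w ∧ E p.1 (p.2 + 1) ≤ i₀) then
    (if E (p.1 + 1) p.2 < E p.1 (p.2 + 1) then (p.1 + 1, p.2) else (p.1, p.2 + 1))
  else if p.1 + 1 < d ∧ E (p.1 + 1) p.2 ≤ i₀ then (p.1 + 1, p.2)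
  else if p.2 + 1 < w ∧ E p.1 (p.2 + 1) ≤ i₀ then (p.1, p.2 + 1)
  else p

/-- The path of the empty box in the jeu de taquin slide, starting in the
northwest corner. -/
def slidePath (d w i₀ : ℕ) (E : ℕ → ℕ → ℕ) : ℕ → ℕ × ℕ
  | 0 => (0, 0)
  | k + 1 => slideStep d w i₀ E (slidePath d w i₀ E k)

/-- Promotion restricted to the entries `1, …, i₀` (the operator `𝑗_{i₀}`):
delete the entry `1`, slide the empty box through the entries `≤ i₀`, decrement
those entries by one and place `i₀` in the final empty box. -/
def partialPromo (d w i₀ : ℕ) (E : ℕ → ℕ → ℕ) : ℕ → ℕ → ℕ := fun i j =>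
  if d ≤ i ∨ w ≤ j then 0
  else if (i, j) = slidePath d w i₀ E i₀ then i₀
  else if slidePath d w i₀ E (i + j) = (i, j) then
    E (slidePath d w i₀ E (i + j + 1)).1 (slidePath d w i₀ E (i + j + 1)).2 - 1
  else if E i j ≤ i₀ then E i j - 1
  else E i j

/-- Jeu de taquin promotion `𝑗` on fillings of the `d × w` rectangle. -/
def promo (d w : ℕ) (E : ℕ → ℕ → ℕ) : ℕ → ℕ → ℕ := partialPromo d w (d * w) E

/-- `evacAux d w i = 𝑗_1 ∘ 𝑗_2 ∘ ⋯ ∘ 𝑗_i`. -/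
def evacAux (d w : ℕ) : ℕ → (ℕ → ℕ → ℕ) → (ℕ → ℕ → ℕ)
  | 0, E => E
  | i + 1, E => evacAux d w i (partialPromo d w (i + 1) E)

/-- Evacuation `𝑒 = 𝑗_1 ∘ 𝑗_2 ∘ ⋯ ∘ 𝑗_N` on fillings of the `d × w` rectangle. -/
def evac (d w : ℕ) (E : ℕ → ℕ → ℕ) : ℕ → ℕ → ℕ := evacAux d w (d * w) E

/-- The `C_r`-fixed polynomial `z^m (z^r + h_1) ⋯ (z^r + h_ℓ)`. -/
def crPoly (r m ℓ : ℕ) (hs : Fin ℓ → ℂ) : Polynomial ℂ :=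
  Polynomial.X ^ m * ∏ i : Fin ℓ, (Polynomial.X ^ r + Polynomial.C (hs i))

/-- The product `∏ (z^r + a_i)(z^r + a_i⁻¹)` of generic inverse pairs. -/
def pairsPoly (r t : ℕ) (a : Fin t → ℂ) : Polynomial ℂ :=
  ∏ i : Fin t,
    ((Polynomial.X ^ r + Polynomial.C (a i)) * (Polynomial.X ^ r + Polynomial.C (a i)⁻¹))

/-- A `D_r`-fixed polynomial of type (1). -/
def type1poly (r m t : ℕ) (ε : ℂ) (a : Fin t → ℂ) : Polynomial ℂ :=
  Polynomial.X ^ m * (Polynomial.X ^ r + Polynomial.C ε) * pairsPoly r t a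

/-- A `D_r`-fixed polynomial of type (2). -/
def type2poly (r m t : ℕ) (a : Fin t → ℂ) : Polynomial ℂ :=
  Polynomial.X ^ m * pairsPoly r t a

/-- A `D_r`-fixed polynomial of type (3). -/
def type3poly (r m t : ℕ) (a : Fin t → ℂ) : Polynomial ℂ :=
  Polynomial.X ^ m * (Polynomial.X ^ r + 1) * (Polynomial.X ^ r - 1) * pairsPoly r t a

/-- `x` is an even-odd point: it has a basis each of whose members is an even or
an odd polynomial. -/
def IsEvenOddPoint (d : ℕ) (x : Submodule ℂ (Polynomial ℂ)) : Prop :=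
  ∃ f : Fin d → Polynomial ℂ, LinearIndependent ℂ f ∧
    Submodule.span ℂ (Set.range f) = x ∧
    ∀ i, (f i).comp (-Polynomial.X) = f i ∨ (f i).comp (-Polynomial.X) = -(f i)

/-- `x` is a real point: it has a basis of polynomials with real coefficients. -/
def IsRealPoint (d : ℕ) (x : Submodule ℂ (Polynomial ℂ)) : Prop :=
  ∃ f : Fin d → Polynomial ℂ, LinearIndependent ℂ f ∧
    Submodule.span ℂ (Set.range f) = x ∧
    ∀ i k, ((f i).coeff k).im = 0

/-- The Möbius action of a matrix on `ℂℙ¹ = ℂ ∪ {∞}` (modelled by `Option ℂ`,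
with `none` playing the role of `∞`). -/
def mobP1 (M : Matrix (Fin 2) (Fin 2) ℂ) : Option ℂ → Option ℂ := fun p =>
  match p with
  | none => if M 1 0 = 0 then none else some (M 0 0 / M 1 0)
  | some a =>
      if M 1 0 * a + M 1 1 = 0 then none
      else some ((M 0 0 * a + M 0 1) / (M 1 0 * a + M 1 1))

/-- The action of a matrix `φ` on `ℂ_{n-1}[z] `:
`(φf)(z) = (φ₂₁ z + φ₁₁)^{n-1} f((φ₂₂ z + φ₁₂)/(φ₂₁ z + φ₁₁))`. -/
def mobiusMap (n : ℕ) (M : Matrix (Fin 2) (Fin 2) ℂ) : Polynomial ℂ →ₗ[ℂ] Polynomial ℂ :=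
  ∑ k ∈ Finset.range n, (Polynomial.lcoeff ℂ k).smulRight
    ((Polynomial.C (M 1 1) * Polynomial.X + Polynomial.C (M 0 1)) ^ k *
     (Polynomial.C (M 1 0) * Polynomial.X + Polynomial.C (M 0 0)) ^ (n - 1 - k))

/-- The polynomial `∏_{a_i ≠ ∞} (z + a_i)` attached to a tuple of points of `ℂℙ¹`. -/
def rootsPoly (N : ℕ) (a : Fin N → Option ℂ) : Polynomial ℂ :=
  ∏ i : Fin N, (a i).elim 1 (fun c => Polynomial.X + Polynomial.C c)

/-- The eigenspace `M_k`: the span of the monomials `z^j`, `j < n`, `j ≡ k (mod r)`. -/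
def eigSpace (n r : ℕ) (k : Fin r) : Submodule ℂ (Polynomial ℂ) :=
  Submodule.span ℂ {p : Polynomial ℂ | ∃ j : ℕ, j < n ∧ j % r = (k : ℕ) ∧ p = Polynomial.X ^ j}

/-- The operator `c` on `ℂ_{n-1}[z]` with `c · z^k = ζ^{n-1-2k} z^k`, `ζ = e^{πi/r}`. -/
def cMap (n r : ℕ) : Polynomial ℂ →ₗ[ℂ] Polynomial ℂ :=
  (Complex.exp ((Real.pi : ℂ) * Complex.I / (r : ℂ))) ^ (n - 1) •
    (Polynomial.aeval
        (Polynomial.C (((Complex.exp ((Real.pi : ℂ) * Complex.I / (r : ℂ))) ^ 2)⁻¹) *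
          Polynomial.X) :
      Polynomial ℂ →ₐ[ℂ] Polynomial ℂ).toLinearMap

/-- `μ` is obtained from `λ` by removing a single `r`-ribbon. -/
def RibbonStep {d w : ℕ} (r : ℕ) (lam mu : PartitionIn d w) : Prop :=
  SubPartition mu lam ∧ IsRibbon r {p : ℕ × ℕ | InShape lam mu p.1 p.2}

/-- `λ` and `μ` have the same `r`-core: they are related by the equivalence
relation generated by removal of a single `r`-ribbon. -/
def RibbonEquiv {d w : ℕ} (r : ℕ) (lam mu : PartitionIn d w) : Prop :=
  Relation.EqvGen (fun a b => RibbonStep r a b) lam mu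

/-- `κ` is an `r`-core: no `r`-ribbon can be removed from it. -/
def IsRCore {d w : ℕ} (r : ℕ) (kappa : PartitionIn d w) : Prop :=
  ¬ ∃ mu : PartitionIn d w, RibbonStep r kappa mu

/-- The column set `J(λ) = {i - 1 + λ^{d+1-i} : 1 ≤ i ≤ d}` of the Plücker
coordinate `p_λ`, as a function of `i`. -/
def pluckerIndex {d w : ℕ} (lam : PartitionIn d w) (i : Fin d) : ℕ :=
  (i : ℕ) + lam.part (d - 1 - (i : ℕ))

/-- The Plücker coordinate `p_λ(x)` of `x` is nonzero (this does not depend on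
the choice of basis of `x`). -/
def PluckerNonzero (d : ℕ) {w : ℕ} (lam : PartitionIn d w)
    (x : Submodule ℂ (Polynomial ℂ)) : Prop :=
  ∃ f : Fin d → Polynomial ℂ, LinearIndependent ℂ f ∧
    Submodule.span ℂ (Set.range f) = x ∧
    Matrix.det (Matrix.of fun i i' : Fin d => (f i).coeff (pluckerIndex lam i')) ≠ 0

end

namespace S14
/-- toggle on content sequences -/
def tg (i : ℕ) (f : ℕ → ℤ) : ℕ → ℤ :=
  if f i - f (i+1) = 1 ∨ f (i+1) - f i = 1 then f else f ∘ Equiv.swap i (i+1)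

/-- elementary dual equivalence on content sequences -/
def dk (i : ℕ) (f : ℕ → ℤ) : ℕ → ℤ :=
  if (f i < f (i+2) ∧ f (i+2) < f (i+1)) ∨ (f (i+1) < f (i+2) ∧ f (i+2) < f i) then
    f ∘ Equiv.swap i (i+1)
  else if (f (i+1) < f i ∧ f i < f (i+2)) ∨ (f (i+2) < f i ∧ f i < f (i+1)) then
    f ∘ Equiv.swap (i+1) (i+2)
  else f

lemma swap_ap (f : ℕ → ℤ) (i k : ℕ) :
    (f ∘ Equiv.swap i (i+1)) k = if k = i then f (i+1) else if k = i+1 then f i else f k := by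
  simp only [Function.comp, Equiv.swap_apply_def]; split_ifs <;> rfl

lemma tg_ap (i : ℕ) (f : ℕ → ℤ) (k : ℕ) : tg i f k =
    if f i - f (i+1) = 1 ∨ f (i+1) - f i = 1 then f k else
      if k = i then f (i+1) else if k = i+1 then f i else f k := by
  unfold tg; split_ifs <;> simp_all [Equiv.swap_apply_def]

lemma dk_ap (i : ℕ) (f : ℕ → ℤ) (k : ℕ) : dk i f k =
    if (f i < f (i+2) ∧ f (i+2) < f (i+1)) ∨ (f (i+1) < f (i+2) ∧ f (i+2) < f i) then
      if k = i then f (i+1) else if k = i+1 then f i else f k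
    else if (f (i+1) < f i ∧ f i < f (i+2)) ∨ (f (i+2) < f i ∧ f i < f (i+1)) then
      if k = i+1 then f (i+2) else if k = i+2 then f (i+1) else f k
    else f k := by
  unfold dk
  split_ifs with h1 h2 h3 h4 h5 <;> first | rw [swap_ap] | rw [swap_ap f (i+1)] | skip
  all_goals simp_all

lemma tg_tg (i : ℕ) (f : ℕ → ℤ) : tg i (tg i f) = f := by
  funext k
  simp only [tg_ap]
  grind

lemma tg_comm (i l : ℕ) (h : i + 2 ≤ l) (f : ℕ → ℤ) : tg i (tg l f) = tg l (tg i f) := by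
  funext k
  simp only [tg_ap]
  grind

lemma dk_dk (i : ℕ) (f : ℕ → ℤ) : dk i (dk i f) = f := by
  funext k
  simp only [dk_ap]
  grind

lemma tg_off (i : ℕ) (f : ℕ → ℤ) (k : ℕ) (h1 : k ≠ i) (h2 : k ≠ i + 1) : tg i f k = f k := by
  rw [tg_ap]; simp [h1, h2]

lemma dk_off (i : ℕ) (f : ℕ → ℤ) (k : ℕ) (h1 : k ≠ i) (h2 : k ≠ i + 1) (h3 : k ≠ i + 2) :
    dk i f k = f k := by
  rw [dk_ap]; simp [h1, h2, h3]

lemma tg_dk_comm (i l : ℕ) (h : l + 1 < i ∨ i + 2 < l) (f : ℕ → ℤ) :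
    tg l (dk i f) = dk i (tg l f) := by
  have e1 : dk i f l = f l := dk_off _ _ _ (by omega) (by omega) (by omega)
  have e2 : dk i f (l+1) = f (l+1) := dk_off _ _ _ (by omega) (by omega) (by omega)
  have e3 : tg l f i = f i := tg_off _ _ _ (by omega) (by omega)
  have e4 : tg l f (i+1) = f (i+1) := tg_off _ _ _ (by omega) (by omega)
  have e5 : tg l f (i+2) = f (i+2) := tg_off _ _ _ (by omega) (by omega)
  funext k
  rw [tg_ap l (dk i f), dk_ap i (tg l f), e1, e2, e3, e4, e5]
  by_cases hk : k = l ∨ k = l + 1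
  · have h1 : k ≠ i := by omega
    have h2 : k ≠ i + 1 := by omega
    have h3 : k ≠ i + 2 := by omega
    simp only [h1, h2, h3, if_false, ite_self, dk_off i f k h1 h2 h3, tg_ap]
  · push Not at hk
    simp only [hk.1, hk.2, if_false, ite_self, tg_off l f k hk.1 hk.2, dk_ap]

lemma tg_vals (i : ℕ) (f : ℕ → ℤ) :
    ((f i - f (i+1) = 1 ∨ f (i+1) - f i = 1) ∧ tg i f i = f i ∧ tg i f (i+1) = f (i+1)) ∨
    (¬ (f i - f (i+1) = 1 ∨ f (i+1) - f i = 1) ∧ tg i f i = f (i+1) ∧ tg i f (i+1) = f i) := by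
  simp only [tg_ap]
  by_cases h : (f i - f (i+1) = 1 ∨ f (i+1) - f i = 1)
  · left; simp [h]
  · right; simp [h]

lemma dk_vals (i : ℕ) (f : ℕ → ℤ) :
    (((f i < f (i+2) ∧ f (i+2) < f (i+1)) ∨ (f (i+1) < f (i+2) ∧ f (i+2) < f i)) ∧
      dk i f i = f (i+1) ∧ dk i f (i+1) = f i ∧ dk i f (i+2) = f (i+2)) ∨
    (((f (i+1) < f i ∧ f i < f (i+2)) ∨ (f (i+2) < f i ∧ f i < f (i+1))) ∧
      dk i f i = f i ∧ dk i f (i+1) = f (i+2) ∧ dk i f (i+2) = f (i+1)) ∨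
    ((¬ ((f i < f (i+2) ∧ f (i+2) < f (i+1)) ∨ (f (i+1) < f (i+2) ∧ f (i+2) < f i)) ∧
      ¬ ((f (i+1) < f i ∧ f i < f (i+2)) ∨ (f (i+2) < f i ∧ f i < f (i+1)))) ∧
      dk i f i = f i ∧ dk i f (i+1) = f (i+1) ∧ dk i f (i+2) = f (i+2)) := by
  simp only [dk_ap]
  by_cases h : ((f i < f (i+2) ∧ f (i+2) < f (i+1)) ∨ (f (i+1) < f (i+2) ∧ f (i+2) < f i))
  · left; simp [h]
  · right
    by_cases h' : ((f (i+1) < f i ∧ f i < f (i+2)) ∨ (f (i+2) < f i ∧ f i < f (i+1)))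
    · left; simp only [h, h', if_true, if_false]; simp
    · right; simp only [h, h', if_false]; simp

set_option maxHeartbeats 4000000 in
lemma key_int (i : ℕ) (f : ℕ → ℤ) (h1 : f i ≠ f (i+1)) (h2 : f i ≠ f (i+2)) (h3 : f (i+1) ≠ f (i+2))
    (h4 : f (i+1) ≠ f (i+3)) (h5 : f (i+2) ≠ f (i+3))
    (h6 : f i = f (i+3) → (f (i+1) = f i + 1 ∧ f (i+2) = f i - 1) ∨ (f (i+1) = f i - 1 ∧ f (i+2) = f i + 1)) :
    tg (i+2) (tg (i+1) (tg i (dk (i+1) f))) = dk i (tg (i+2) (tg (i+1) (tg i f))) := by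
  have main : ∀ g0 g1 g2 g3 k1 k2 k3 k4: ℕ → ℤ, g0 = dk (i+1) f → g1 = tg i g0 → g2 = tg (i+1) g1 →
      g3 = tg (i+2) g2 → k1 = tg i f → k2 = tg (i+1) k1 → k3 = tg (i+2) k2 → k4 = dk i k3 → 
      g3 i = k4 i ∧ g3 (i+1) = k4 (i+1) ∧ g3 (i+2) = k4 (i+2) ∧ g3 (i+3) = k4 (i+3) := by
    intro g0 g1 g2 g3 k1 k2 k3 k4 a0 a1 a2 a3 b1 b2 b3 b4
    have A0 := dk_vals (i+1) f
    have A0' := dk_off (i+1) f i (by omega) (by omega) (by omega)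
    have A1 := tg_vals i g0
    have A1' := tg_off i g0 (i+2) (by omega) (by omega)
    have A1'' := tg_off i g0 (i+3) (by omega) (by omega)
    have A2 := tg_vals (i+1) g1
    have A2' := tg_off (i+1) g1 i (by omega) (by omega)
    have A2'' := tg_off (i+1) g1 (i+3) (by omega) (by omega)
    have A3 := tg_vals (i+2) g2
    have A3' := tg_off (i+2) g2 i (by omega) (by omega)
    have A3'' := tg_off (i+2) g2 (i+1) (by omega) (by omega)
    have B1 := tg_vals i f
    have B1' := tg_off i f (i+2) (by omega) (by omega)
    have B1'' := tg_off i f (i+3) (by omega) (by omega)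
    have B2 := tg_vals (i+1) k1
    have B2' := tg_off (i+1) k1 i (by omega) (by omega)
    have B2'' := tg_off (i+1) k1 (i+3) (by omega) (by omega)
    have B3 := tg_vals (i+2) k2
    have B3' := tg_off (i+2) k2 i (by omega) (by omega)
    have B3'' := tg_off (i+2) k2 (i+1) (by omega) (by omega)
    have B4 := dk_vals i k3
    have B4' := dk_off i k3 (i+3) (by omega) (by omega) (by omega)
    simp only [add_assoc, Nat.reduceAdd] at *
    rw [← a0] at A0 A0'
    rw [← a1] at A1 A1' A1''
    rw [← a2] at A2 A2' A2''
    rw [← a3] at A3 A3' A3''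
    rw [← b1] at B1 B1' B1''
    rw [← b2] at B2 B2' B2''
    rw [← b3] at B3 B3' B3''
    rw [← b4] at B4 B4'
    clear a0 a1 a2 a3 b1 b2 b3 b4
    have h14 : f i < f (i+3) ∨ f i > f (i+3) ∨ f i = f (i+3) := by
      clear * -
      omega
    rcases lt_or_gt_of_ne h1 with h1 | h1 <;> rcases lt_or_gt_of_ne h2 with h2 | h2 <;>
      rcases lt_or_gt_of_ne h3 with h3 | h3 <;> (try (clear * - h1 h2 h3; omega)) <;>
      rcases lt_or_gt_of_ne h4 with h4 | h4 <;>
      rcases lt_or_gt_of_ne h5 with h5 | h5 <;> (try (clear * - h3 h4 h5; omega)) <;>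
      rcases h14 with h14 | h14 | h14 <;> (try (clear * - h1 h2 h3 h4 h5 h6 h14; omega)) <;>
      (first | (have h6 := h6 h14) | clear h6) <;>
    rcases A0 with ⟨A0, A01, A02, A03⟩ | ⟨A0, A01, A02, A03⟩ | ⟨A0, A01, A02, A03⟩ <;> (try (clear * - A0 h1 h2 h3 h4 h5; omega)) <;> clear A0 <;>
      rw [A0', A01] at A1 <;> rw [A02] at A1' <;> rw [A03] at A1'' <;> clear A01 A02 A03 A0' <;>
      rcases A1 with ⟨A1, A11, A12⟩ | ⟨A1, A11, A12⟩ <;>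
      rw [A12, A1'] at A2 <;> rw [A11] at A2' <;> rw [A1''] at A2'' <;> clear A11 A12 A1' A1'' <;>
      rcases A2 with ⟨A2, A21, A22⟩ | ⟨A2, A21, A22⟩ <;>
      rw [A22, A2''] at A3 <;> rw [A2'] at A3' <;> rw [A21] at A3'' <;> clear A21 A22 A2' A2'' <;>
      rcases A3 with ⟨A3, A31, A32⟩ | ⟨A3, A31, A32⟩ <;>
      rw [A3', A3'', A31, A32] <;> clear A31 A32 A3' A3'' <;>
      (try (clear B1 B2 B3 B4; omega)) <;>
      rcases B1 with ⟨B1, B11, B12⟩ | ⟨B1, B11, B12⟩ <;> (try (clear B2 B3 B4; omega)) <;>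
      rw [B12, B1'] at B2 <;> rw [B11] at B2' <;> rw [B1''] at B2'' <;> clear B11 B12 B1' B1'' <;>
      rcases B2 with ⟨B2, B21, B22⟩ | ⟨B2, B21, B22⟩ <;> (try (clear B3 B4; omega)) <;>
      rw [B22, B2''] at B3 <;> rw [B2'] at B3' <;> rw [B21] at B3'' <;> clear B21 B22 B2' B2'' <;>
      rcases B3 with ⟨B3, B31, B32⟩ | ⟨B3, B31, B32⟩ <;> (try (clear B4; omega)) <;>
      rw [B3', B3'', B31] at B4 <;> rw [B32] at B4' <;> clear B31 B32 B3' B3'' <;> 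
      rw [B4'] <;> omega
  have M := main _ _ _ _ _ _ _ _ rfl rfl rfl rfl rfl rfl rfl rfl
  funext k
  by_cases k0 : k = i
  · subst k0; exact M.1
  by_cases k1 : k = i + 1
  · subst k1; exact M.2.1
  by_cases k2 : k = i + 2
  · subst k2; exact M.2.2.1
  by_cases k3 : k = i + 3
  · subst k3; exact M.2.2.2
  rw [tg_off _ _ _ k2 k3, tg_off _ _ _ k1 k2, tg_off _ _ _ k0 k1, dk_off _ _ _ k1 k2 k3,
    dk_off _ _ _ k0 k1 k2, tg_off _ _ _ k2 k3, tg_off _ _ _ k1 k2, tg_off _ _ _ k0 k1]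

/-- descents are shifted by a slide -/
lemma desc_int (i : ℕ) (f : ℕ → ℤ) (h1 : f i ≠ f (i+1)) (h2 : f i ≠ f (i+2)) (h3 : f (i+1) ≠ f (i+2)) :
    (tg (i+1) (tg i f) (i+1) < tg (i+1) (tg i f) i ↔ f (i+2) < f (i+1)) := by
  have A1 := tg_vals i f
  have A1' := tg_off i f (i+2) (by omega) (by omega)
  have A2 := tg_vals (i+1) (tg i f)
  have A2' := tg_off (i+1) (tg i f) i (by omega) (by omega)
  simp only [add_assoc, Nat.reduceAdd] at *
  omega

end S14

namespace S14
/-- toggles as permutations -/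
def tP (i : ℕ) : Equiv.Perm (ℕ → ℤ) := ⟨tg i, tg i, tg_tg i, tg_tg i⟩

@[simp] lemma tP_apply (i : ℕ) (f : ℕ → ℤ) : tP i f = tg i f := rfl

lemma tP_sq (i : ℕ) : tP i * tP i = 1 := by
  ext1 f; exact tg_tg i f

lemma tP_comm (i l : ℕ) (h : i + 2 ≤ l) : tP i * tP l = tP l * tP i := by
  ext1 f; exact tg_comm i l h f

/-- promotion on the first `k+1` positions -/
def J : ℕ → Equiv.Perm (ℕ → ℤ)
  | 0 => 1
  | k + 1 => tP k * J k

/-- evacuation on the first `k+1` positions -/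
def Ev : ℕ → Equiv.Perm (ℕ → ℤ)
  | 0 => 1
  | k + 1 => Ev k * J (k + 1)

lemma J_comm (k l : ℕ) (h : k + 1 ≤ l) : Commute (tP l) (J k) := by
  induction k with
  | zero => exact Commute.one_right _
  | succ k ih =>
    exact Commute.mul_right (tP_comm k l (by omega)).symm (ih (by omega))

lemma Ev_comm (k l : ℕ) (h : k + 1 ≤ l) : Commute (tP l) (Ev k) := by
  induction k with
  | zero => exact Commute.one_right _
  | succ k ih =>
    exact Commute.mul_right (ih (by omega)) (J_comm _ _ h)

lemma JEJ (k : ℕ) : J (k+1) * Ev k * J (k+1) = Ev k := by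
  induction k with
  | zero => simpa [J, Ev] using tP_sq 0
  | succ k ih =>
    have h1 : J (k+1) * Ev (k+1) = Ev k := by
      rw [Ev, ← mul_assoc, ih]
    calc J (k+2) * Ev (k+1) * J (k+2)
        = tP (k+1) * (J (k+1) * Ev (k+1)) * (tP (k+1) * J (k+1)) := by
          rw [show J (k+2) = tP (k+1) * J (k+1) from rfl]; simp only [mul_assoc]
      _ = (tP (k+1) * Ev k) * (tP (k+1) * J (k+1)) := by rw [h1]
      _ = (Ev k * tP (k+1)) * (tP (k+1) * J (k+1)) := by rw [(Ev_comm k (k+1) (by omega)).eq]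
      _ = Ev k * (tP (k+1) * tP (k+1)) * J (k+1) := by simp only [mul_assoc]
      _ = Ev (k+1) := by rw [tP_sq, mul_one]; rfl

lemma J_Ev (k : ℕ) : J (k+1) * Ev (k+1) = Ev k := by
  rw [Ev, ← mul_assoc, JEJ]

lemma Ev_sq (k : ℕ) : Ev k * Ev k = 1 := by
  induction k with
  | zero => simp [Ev]
  | succ k ih =>
    calc Ev (k+1) * Ev (k+1) = Ev k * (J (k+1) * Ev (k+1)) := by
          conv_lhs => rw [show Ev (k+1) = Ev k * J (k+1) from rfl]
          rw [mul_assoc]; rfl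
      _ = 1 := by rw [J_Ev, ih]

/-- rotation of content sequences -/
def rotF (N : ℕ) (K : ℤ) (f : ℕ → ℤ) : ℕ → ℤ := fun k => if k < N then K - f (N - 1 - k) else f k

lemma rotF_rotF (N : ℕ) (K : ℤ) (f : ℕ → ℤ) : rotF N K (rotF N K f) = f := by
  funext k
  unfold rotF
  by_cases h : k < N
  · have h2 : N - 1 - k < N := by omega
    have h3 : N - 1 - (N - 1 - k) = k := by omega
    simp [h, h2, h3]
  · simp [h]

/-- rotation as a permutation -/
def RP (N : ℕ) (K : ℤ) : Equiv.Perm (ℕ → ℤ) := ⟨rotF N K, rotF N K, rotF_rotF N K, rotF_rotF N K⟩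

lemma RP_sq (N : ℕ) (K : ℤ) : RP N K * RP N K = 1 := by
  ext1 f; exact rotF_rotF N K f

lemma rot_tg (N : ℕ) (K : ℤ) (i : ℕ) (h : i + 2 ≤ N) (f : ℕ → ℤ) :
    rotF N K (tg i f) = tg (N - 2 - i) (rotF N K f) := by
  obtain ⟨m, rfl⟩ : ∃ m, N = i + 2 + m := ⟨N - (i+2), by omega⟩
  have e : i + 2 + m - 2 - i = m := by omega
  rw [e]
  have a1 : rotF (i+2+m) K f m = K - f (i+1) := by
    unfold rotF; rw [if_pos (by omega)]; congr 2; omega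
  have a2 : rotF (i+2+m) K f (m+1) = K - f i := by
    unfold rotF; rw [if_pos (by omega)]; congr 2; omega
  funext k
  rw [tg_ap m, a1, a2]
  unfold rotF
  by_cases hk : k < i + 2 + m
  · rw [if_pos hk, if_pos hk, tg_ap]
    have b1 : (i + 2 + m - 1 - k = i) ↔ k = m + 1 := by omega
    have b2 : (i + 2 + m - 1 - k = i + 1) ↔ k = m := by omega
    simp only [b1, b2]
    by_cases k1 : k = m
    · subst k1
      have : i + 2 + k - 1 - k = i + 1 := by omega
      rw [this]
      split_ifs <;> omega
    by_cases k2 : k = m + 1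
    · subst k2
      have : i + 2 + m - 1 - (m+1) = i := by omega
      rw [this]
      split_ifs <;> omega
    simp [k1, k2]
  · have k1 : k ≠ m := by omega
    have k2 : k ≠ m + 1 := by omega
    rw [if_neg hk, if_neg hk, tg_off _ _ _ (by omega) (by omega)]
    simp [k1, k2]

lemma rot_dk (N : ℕ) (K : ℤ) (i : ℕ) (h : i + 3 ≤ N) (f : ℕ → ℤ) :
    rotF N K (dk i f) = dk (N - 3 - i) (rotF N K f) := by
  obtain ⟨m, rfl⟩ : ∃ m, N = i + 3 + m := ⟨N - (i+3), by omega⟩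
  have e : i + 3 + m - 3 - i = m := by omega
  rw [e]
  have a : ∀ (f : ℕ → ℤ) k j, k + j = i + 2 + m → rotF (i+3+m) K f k = K - f j := by
    intro f k j hkj
    unfold rotF; rw [if_pos (by omega)]; congr 2; omega
  have D := dk_vals i f
  have D' := dk_vals m (rotF (i+3+m) K f)
  rw [a f m (i+2) (by omega), a f (m+1) (i+1) (by omega), a f (m+2) i (by omega)] at D'
  funext k
  by_cases k0 : k = m
  · subst k0
    rw [a _ k (i+2) (by omega)]
    omega
  by_cases k1 : k = m + 1
  · subst k1
    rw [a _ (m+1) (i+1) (by omega)]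
    omega
  by_cases k2 : k = m + 2
  · subst k2
    rw [a _ (m+2) i (by omega)]
    omega
  rw [dk_off _ _ _ k0 k1 k2]
  by_cases hk : k < i + 3 + m
  · obtain ⟨j, hj⟩ : ∃ j, k + j = i + 2 + m := ⟨i + 2 + m - k, by omega⟩
    rw [a _ k j hj, a _ k j hj, dk_off _ _ _ (by omega) (by omega) (by omega)]
  · unfold rotF
    rw [if_neg hk, if_neg hk, dk_off _ _ _ (by omega) (by omega) (by omega)]

/-- dual evacuation -/
def Ed (N : ℕ) (K : ℤ) (k : ℕ) : Equiv.Perm (ℕ → ℤ) := RP N K * Ev k * RP N K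

lemma conj_t (N : ℕ) (K : ℤ) (i : ℕ) (h : i + 2 ≤ N) :
    RP N K * tP i * RP N K = tP (N - 2 - i) := by
  ext1 f
  change rotF N K (tg i (rotF N K f)) = _
  rw [rot_tg N K i h, rotF_rotF]; rfl

lemma Ed_comm_J (N : ℕ) (K : ℤ) (k : ℕ) : ∀ j, j + k + 2 ≤ N → Commute (J j) (Ed N K k)
  | 0, _ => Commute.one_left _
  | j + 1, h => by
    have h1 := Ed_comm_J N K k j (by omega)
    refine Commute.mul_left ?_ h1
    have h2 := Ev_comm k (N - 2 - j) (by omega)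
    have h3 := conj_t N K (N - 2 - j) (by omega)
    have h4 : N - 2 - (N - 2 - j) = j := by omega
    rw [h4] at h3
    rw [← h3]
    have hR := RP_sq N K
    change _ * _ = _ * _
    unfold Ed
    calc RP N K * tP (N-2-j) * RP N K * (RP N K * Ev k * RP N K)
        = RP N K * tP (N-2-j) * (RP N K * RP N K) * Ev k * RP N K := by simp only [mul_assoc]
      _ = RP N K * (tP (N-2-j) * Ev k) * RP N K := by rw [hR, mul_one]; simp only [mul_assoc]
      _ = RP N K * (Ev k * tP (N-2-j)) * RP N K := by rw [h2.eq]
      _ = RP N K * Ev k * (RP N K * RP N K) * tP (N-2-j) * RP N K := by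
          rw [hR, mul_one]; simp only [mul_assoc]
      _ = _ := by simp only [mul_assoc]

/-- `tail N m k` is `t_{m+k-1} ... t_m` -/
def tail (m : ℕ) : ℕ → Equiv.Perm (ℕ → ℤ)
  | 0 => 1
  | k + 1 => tP (m + k) * tail m k

lemma J_split (m : ℕ) : ∀ k, J (m + k) = tail m k * J m
  | 0 => by simp [tail]
  | k + 1 => by
    change tP (m+k) * J (m + k) = tP (m+k) * tail m k * J m
    rw [J_split m k, mul_assoc]

lemma conj_Jinv (N : ℕ) (K : ℤ) : ∀ k, k + 1 ≤ N →
    RP N K * (J k)⁻¹ * RP N K = tail (N - 1 - k) k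
  | 0, _ => by simp [J, tail, RP_sq]
  | k + 1, h => by
    have ih := conj_Jinv N K k (by omega)
    have hR := RP_sq N K
    have ht : (tP k)⁻¹ = tP k := inv_eq_of_mul_eq_one_left (tP_sq k)
    have tl : ∀ m k, tail m (k+1) = tail (m+1) k * tP m := by
      intro m k
      induction k with
      | zero => simp [tail]
      | succ k ih =>
        rw [tail, ih, tail, mul_assoc, show m + (k+1) = m + 1 + k by omega]
    rw [tl, show N - 1 - (k+1) + 1 = N - 1 - k by omega, ← ih, show N - 1 - (k+1) = N - 2 - k by omega,
      ← conj_t N K k (by omega)]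
    calc RP N K * (J (k+1))⁻¹ * RP N K = RP N K * ((J k)⁻¹ * tP k) * RP N K := by
          rw [J, mul_inv_rev, ht]
      _ = RP N K * (J k)⁻¹ * (RP N K * RP N K) * tP k * RP N K := by
          rw [hR, mul_one]; simp only [mul_assoc]
      _ = _ := by simp only [mul_assoc]

lemma J_pow (N : ℕ) (K : ℤ) : ∀ k, k + 2 ≤ N →
    J (N-1) ^ (k+1) * Ev (N-1) = Ed N K k * Ev (N - 2 - k)
  | 0, h => by
    obtain ⟨m, rfl⟩ : ∃ m, N = m + 2 := ⟨N - 2, by omega⟩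
    simp only [Ed, Ev, mul_one, RP_sq, pow_one, one_mul, zero_add]
    exact J_Ev m
  | k + 1, h => by
    obtain ⟨m, rfl⟩ : ∃ m, N = m + k + 3 := ⟨N - k - 3, by omega⟩
    have ih := J_pow (m+k+3) K k (by omega)
    have e1 : m + k + 3 - 1 = (m + 1) + (k + 1) := by omega
    have e2 : m + k + 3 - 2 - k = m + 1 := by omega
    have e3 : m + k + 3 - 2 - (k + 1) = m := by omega
    rw [e2] at ih
    rw [e3, pow_succ', mul_assoc, ih]
    have hc := (Ed_comm_J (m+k+3) K k (m+1) (by omega)).eq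
    have hs := J_split (m+1) (k+1)
    rw [e1, hs]
    have hj := conj_Jinv (m+k+3) K (k+1) (by omega)
    rw [show m + k + 3 - 1 - (k+1) = m + 1 by omega] at hj
    have hE : (J (k+1))⁻¹ * Ev k = Ev (k+1) := by rw [← J_Ev k]; group
    have hR := RP_sq (m+k+3) K
    calc tail (m+1) (k+1) * J (m+1) * (Ed (m+k+3) K k * Ev (m+1))
        = tail (m+1) (k+1) * (J (m+1) * Ed (m+k+3) K k) * Ev (m+1) := by simp only [mul_assoc]
      _ = tail (m+1) (k+1) * Ed (m+k+3) K k * (J (m+1) * Ev (m+1)) := by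
          rw [hc]; simp only [mul_assoc]
      _ = tail (m+1) (k+1) * Ed (m+k+3) K k * Ev m := by rw [J_Ev]
      _ = RP (m+k+3) K * (J (k+1))⁻¹ * (RP (m+k+3) K * RP (m+k+3) K) * Ev k * RP (m+k+3) K * Ev m := by
          rw [← hj]; unfold Ed; simp only [mul_assoc]
      _ = RP (m+k+3) K * ((J (k+1))⁻¹ * Ev k) * RP (m+k+3) K * Ev m := by
          rw [hR, mul_one]; simp only [mul_assoc]
      _ = _ := by rw [hE]; rfl

/-- properties of content sequences -/
structure Good (N : ℕ) (f : ℕ → ℤ) : Prop where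
  up : ∀ k l, k < l → l < N → f k = f l → ∃ m, k < m ∧ m < l ∧ f m = f k + 1
  dn : ∀ k l, k < l → l < N → f k = f l → ∃ m, k < m ∧ m < l ∧ f m = f k - 1
  pos : ∀ k, k < N → 0 < f k → ∃ m, m < k ∧ f m = f k - 1
  neg : ∀ k, k < N → f k < 0 → ∃ m, m < k ∧ f m = f k + 1

lemma Good.ne1 {N : ℕ} {f : ℕ → ℤ} (h : Good N f) (k : ℕ) (hk : k + 1 < N) : f k ≠ f (k+1) := by
  intro e
  obtain ⟨m, h1, h2, _⟩ := h.up k (k+1) (by omega) hk e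
  omega

lemma Good.ne2 {N : ℕ} {f : ℕ → ℤ} (h : Good N f) (k : ℕ) (hk : k + 2 < N) : f k ≠ f (k+2) := by
  intro e
  obtain ⟨m, h1, h2, h3⟩ := h.up k (k+2) (by omega) hk e
  obtain ⟨m', h1', h2', h3'⟩ := h.dn k (k+2) (by omega) hk e
  have : m = k + 1 := by omega
  have : m' = k + 1 := by omega
  subst m; subst m'; omega

lemma Good.ne3 {N : ℕ} {f : ℕ → ℤ} (h : Good N f) (k : ℕ) (hk : k + 3 < N) (e : f k = f (k+3)) :
    (f (k+1) = f k + 1 ∧ f (k+2) = f k - 1) ∨ (f (k+1) = f k - 1 ∧ f (k+2) = f k + 1) := by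
  obtain ⟨m, h1, h2, h3⟩ := h.up k (k+3) (by omega) hk e
  obtain ⟨m', h1', h2', h3'⟩ := h.dn k (k+3) (by omega) hk e
  have a : m = k + 1 ∨ m = k + 2 := by omega
  have b : m' = k + 1 ∨ m' = k + 2 := by omega
  rcases a with rfl | rfl <;> rcases b with rfl | rfl <;> omega

lemma Good.zero {N : ℕ} {f : ℕ → ℤ} (h : Good N f) (hN : 0 < N) : f 0 = 0 := by
  rcases lt_trichotomy (f 0) 0 with h1 | h1 | h1
  · obtain ⟨m, h2, _⟩ := h.neg 0 hN h1; omega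
  · exact h1
  · obtain ⟨m, h2, _⟩ := h.pos 0 hN h1; omega

lemma Good.one {N : ℕ} {f : ℕ → ℤ} (h : Good N f) (hN : 1 < N) : f 1 = 1 ∨ f 1 = -1 := by
  have h0 := h.zero (by omega)
  have h01 := h.ne1 0 hN
  simp only [zero_add] at h01
  rcases lt_trichotomy (f 1) 0 with h1 | h1 | h1
  · obtain ⟨m, h2, h3⟩ := h.neg 1 hN h1
    have : m = 0 := by omega
    subst m; omega
  · omega
  · obtain ⟨m, h2, h3⟩ := h.pos 1 hN h1
    have : m = 0 := by omega
    subst m; omega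

lemma Good.tg0 {N : ℕ} {f : ℕ → ℤ} (h : Good N f) (hN : 1 < N) : tg 0 f = f := by
  have h0 := h.zero (by omega)
  have h1 := h.one hN
  unfold tg
  rw [if_pos]
  simp only [zero_add]; omega

lemma Good.tg1 {N : ℕ} {f : ℕ → ℤ} (h : Good N f) (hN : 2 < N) : tg 1 f = dk 0 f := by
  have h0 := h.zero (by omega)
  have h1 := h.one (by omega)
  have h2 := h.ne2 0 hN
  have h3 := h.ne1 1 hN
  have h4 : f 2 < 0 → f 2 = -1 ∨ (f 1 = -1 ∧ f 2 = -2) := by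
    intro hn
    obtain ⟨m, h5, h6⟩ := h.neg 2 hN hn
    have a : m = 0 ∨ m = 1 := by omega
    rcases a with rfl | rfl <;> omega
  have h4' : f 2 > 0 → f 2 = 1 ∨ (f 1 = 1 ∧ f 2 = 2) := by
    intro hn
    obtain ⟨m, h5, h6⟩ := h.pos 2 hN hn
    have a : m = 0 ∨ m = 1 := by omega
    rcases a with rfl | rfl <;> omega
  simp only [zero_add, Nat.reduceAdd] at *
  unfold tg dk
  simp only [zero_add, Nat.reduceAdd]
  rcases h1 with h1 | h1
  · have : f 2 = -1 ∨ f 2 = 2 := by omega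
    rcases this with h5 | h5 <;> simp [h0, h1, h5]
  · have : f 2 = 1 ∨ f 2 = -2 := by omega
    rcases this with h5 | h5 <;> simp [h0, h1, h5]

section V
variable {N : ℕ} {V : Set (ℕ → ℤ)}

lemma J_mem (hcl : ∀ f ∈ V, ∀ i, i + 1 < N → tg i f ∈ V) (k : ℕ) (hk : k + 1 ≤ N) (f : ℕ → ℤ)
    (hf : f ∈ V) : J k f ∈ V := by
  induction k with
  | zero => exact hf
  | succ k ih => exact hcl _ (ih (by omega)) k (by omega)

lemma Ev_mem (hcl : ∀ f ∈ V, ∀ i, i + 1 < N → tg i f ∈ V) (k : ℕ) (hk : k + 1 ≤ N) : ∀ f ∈ V, 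
    Ev k f ∈ V := by
  induction k with
  | zero => exact fun f hf => hf
  | succ k ih => exact fun f hf => ih (by omega) _ (J_mem hcl (k+1) (by omega) f hf)

lemma dk_mem (hg : ∀ f ∈ V, Good N f) (hcl : ∀ f ∈ V, ∀ i, i + 1 < N → tg i f ∈ V) (i : ℕ) (hi : i + 2 < N)
    (f : ℕ → ℤ) (hf : f ∈ V) : dk i f ∈ V := by
  unfold dk
  split_ifs with h1 h2
  · have := hcl f hf i (by omega)
    unfold tg at this
    rwa [if_neg (by omega)] at this
  · have := hcl f hf (i+1) (by omega)
    unfold tg at this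
    simp only [add_assoc, Nat.reduceAdd] at this
    rwa [if_neg (by omega)] at this
  · exact hf

lemma J_dk_low (i : ℕ) (j : ℕ) (h : j ≤ i) (f : ℕ → ℤ) : J j (dk (i+1) f) = dk (i+1) (J j f) := by
  induction j with
  | zero => rfl
  | succ j ih =>
    change tg j (J j _) = dk _ (tg j (J j f))
    rw [ih (by omega), tg_dk_comm _ _ (by omega)]

lemma J_dk (hg : ∀ f ∈ V, Good N f) (hcl : ∀ f ∈ V, ∀ i, i + 1 < N → tg i f ∈ V) (i : ℕ) (f : ℕ → ℤ)
    (hf : f ∈ V) : ∀ k, i + 3 + k < N → J (i + 3 + k) (dk (i+1) f) = dk i (J (i + 3 + k) f)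
  | 0, h => by
    change tg (i+2) (tg (i+1) (tg i (J i (dk (i+1) f)))) = dk i (tg (i+2) (tg (i+1) (tg i (J i f))))
    rw [J_dk_low i i le_rfl]
    have hG := hg _ (J_mem hcl i (by omega) f hf)
    exact key_int i _ (hG.ne1 i (by omega)) (hG.ne2 i (by omega)) (hG.ne1 (i+1) (by omega))
      (hG.ne2 (i+1) (by omega)) (hG.ne1 (i+2) (by omega)) (hG.ne3 i (by omega))
  | k + 1, h => by
    change tg (i+3+k) (J (i+3+k) _) = dk i (tg (i+3+k) (J (i+3+k) f))
    rw [J_dk hg hcl i f hf k (by omega), tg_dk_comm _ _ (by omega)]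

lemma Ev_dk (hg : ∀ f ∈ V, Good N f) (hcl : ∀ f ∈ V, ∀ i, i + 1 < N → tg i f ∈ V) :
    ∀ k, k < N → ∀ i, i + 2 ≤ k → ∀ f ∈ V, Ev k (dk i f) = dk (k - 2 - i) (Ev k f)
  | 0, _, i, hi, f, hf => by omega
  | 1, _, i, hi, f, hf => by omega
  | 2, hN, i, hi, f, hf => by
    have : i = 0 := by omega
    subst this
    have key : ∀ f ∈ V, Ev 2 f = dk 0 f := by
      intro f hf
      have h1 : Ev 2 f = tg 0 (tg 1 (tg 0 f)) := rfl
      rw [h1, (hg f hf).tg0 (by omega), (hg _ (hcl f hf 1 (by omega))).tg0 (by omega),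
        (hg f hf).tg1 hN]
    rw [key f hf, key _ (dk_mem hg hcl 0 hN f hf)]
  | k + 3, hN, i, hi, f, hf => by
    have step : ∀ i, i + 3 ≤ k + 3 → ∀ f ∈ V, Ev (k+3) (dk (i+1) f) = dk (k + 3 - 2 - (i+1)) (Ev (k+3) f) := by
      intro i hi f hf
      change Ev (k+2) (J (k+3) _) = dk _ (Ev (k+2) (J (k+3) f))
      obtain ⟨l, hl⟩ : ∃ l, k + 3 = i + 3 + l := ⟨k - i, by omega⟩
      have hj := J_dk hg hcl i f hf l (by omega)
      rw [← hl] at hj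
      rw [hj, Ev_dk hg hcl (k+2) (by omega) i (by omega) _ (J_mem hcl _ (by omega) f hf)]
      congr 1
      omega
    rcases i with _ | i
    · have hm := Ev_mem hcl (k+3) (by omega) f hf
      have h1 := step k (by omega) _ hm
      have hs : ∀ g, Ev (k+3) (Ev (k+3) g) = g := fun g => by
        have := Ev_sq (k+3)
        exact congrArg (fun p : Equiv.Perm (ℕ → ℤ) => p g) this
      rw [hs, show k + 3 - 2 - (k+1) = 0 by omega] at h1
      rw [← h1, hs]
      congr 1
    · exact step i (by omega) f hf

lemma J_off (j : ℕ) (k : ℕ) (h : j < k) (f : ℕ → ℤ) : J j f k = f k := by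
  induction j with
  | zero => rfl
  | succ j ih =>
    change tg j (J j f) k = _
    rw [tg_off _ _ _ (by omega) (by omega), ih (by omega)]

lemma J_desc (hg : ∀ f ∈ V, Good N f) (hcl : ∀ f ∈ V, ∀ i, i + 1 < N → tg i f ∈ V) (i : ℕ) (f : ℕ → ℤ)
    (hf : f ∈ V) : ∀ k, i + 2 + k < N →
      (J (i + 2 + k) f (i+1) < J (i + 2 + k) f i ↔ f (i+2) < f (i+1))
  | 0, h => by
    change (tg (i+1) (tg i (J i f)) (i+1) < tg (i+1) (tg i (J i f)) i ↔ _)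
    have hG := hg _ (J_mem hcl i (by omega) f hf)
    rw [desc_int i _ (hG.ne1 i (by omega)) (hG.ne2 i (by omega)) (hG.ne1 (i+1) (by omega)),
      J_off _ _ (by omega), J_off _ _ (by omega)]
  | k + 1, h => by
    change (tg (i+2+k) (J (i+2+k) f) (i+1) < tg (i+2+k) (J (i+2+k) f) i ↔ _)
    rw [tg_off _ _ _ (by omega) (by omega), tg_off _ _ _ (by omega) (by omega)]
    exact J_desc hg hcl i f hf k (by omega)

lemma Ev_desc (hg : ∀ f ∈ V, Good N f) (hcl : ∀ f ∈ V, ∀ i, i + 1 < N → tg i f ∈ V) :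
    ∀ k, k < N → ∀ i, i + 1 ≤ k → ∀ f ∈ V,
      (Ev k f (k - 1 - i + 1) < Ev k f (k - 1 - i) ↔ f (i+1) < f i)
  | 0, _, i, hi, f, hf => by omega
  | 1, hN, i, hi, f, hf => by
    have : i = 0 := by omega
    subst this
    have h1 : Ev 1 f = tg 0 f := rfl
    rw [h1, (hg f hf).tg0 (by omega)]
  | k + 2, hN, i, hi, f, hf => by
    have step : ∀ i, i + 2 ≤ k + 2 → ∀ f ∈ V,
        (Ev (k+2) f (k + 2 - 1 - (i + 1) + 1) < Ev (k+2) f (k + 2 - 1 - (i + 1)) ↔ f (i+2) < f (i+1)) := by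
      intro i hi f hf
      change (Ev (k+1) (J (k+2) f) _ < Ev (k+1) (J (k+2) f) _ ↔ _)
      obtain ⟨l, hl⟩ : ∃ l, k + 2 = i + 2 + l := ⟨k - i, by omega⟩
      have hj := J_desc hg hcl i f hf l (by omega)
      rw [← hl] at hj
      rw [← hj, ← Ev_desc hg hcl (k+1) (by omega) i (by omega) _ (J_mem hcl _ (by omega) f hf)]
      rw [show k + 2 - 1 - (i+1) = k + 1 - 1 - i by omega]
    rcases i with _ | i
    · have hm := Ev_mem hcl (k+2) (by omega) f hf
      have h1 := step k (by omega) _ hm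
      have hs : ∀ g, Ev (k+2) (Ev (k+2) g) = g := fun g => by
        have := Ev_sq (k+2)
        exact congrArg (fun p : Equiv.Perm (ℕ → ℤ) => p g) this
      rw [hs, show k + 2 - 1 - (k+1) = 0 by omega] at h1
      rw [h1]
      exact Iff.rfl
    · exact step i (by omega) f hf
end V
end S14

namespace S14

section C
variable {d w : ℕ} {E E' : ℕ → ℕ → ℕ}

lemma syt_inj (h : IsSYT d w E) {a b a' b' : ℕ} (ha : a < d) (hb : b < w) (ha' : a' < d) (hb' : b' < w)
    (e : E a b = E a' b') : a = a' ∧ b = b' := by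
  have hs : Set.SurjOn (fun p : ℕ × ℕ => E p.1 p.2) ↑(Finset.range d ×ˢ Finset.range w)
      ↑(Finset.Icc 1 (d*w)) := by
    intro m hm
    simp only [Finset.coe_Icc, Set.mem_Icc] at hm
    obtain ⟨i, j, hi, hj, hij⟩ := h.2.2.2.2 m hm.1 hm.2
    exact ⟨(i, j), by simp [hi, hj], hij⟩
  have hi := Finset.injOn_of_surjOn_of_card_le (s := Finset.range d ×ˢ Finset.range w)
    (t := Finset.Icc 1 (d*w)) (fun p : ℕ × ℕ => E p.1 p.2) (by
      intro p hp
      simp only [Finset.coe_product, Set.mem_prod, Finset.coe_range, Set.mem_Iio] at hp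
      have := h.2.1 p.1 p.2 hp.1 hp.2
      simpa using this) hs (by simp)
  have := hi (x₁ := (a, b)) (x₂ := (a', b')) (by simp [ha, hb]) (by simp [ha', hb']) e
  simpa using this

lemma syt_row (h : IsSYT d w E) {a b : ℕ} (ha : a < d) : ∀ k, b + k < w → E a b + k ≤ E a (b + k)
  | 0, _ => by simp
  | k + 1, hk => by
    have h1 := syt_row h (b := b) ha k (by omega)
    have h2 := h.2.2.1 a (b + k) ha (by omega)
    rw [show b + (k+1) = b + k + 1 by omega]; omega

lemma syt_col (h : IsSYT d w E) {a b : ℕ} (hb : b < w) : ∀ k, a + k < d → E a b + k ≤ E (a + k) b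
  | 0, _ => by simp
  | k + 1, hk => by
    have h1 := syt_col h (a := a) hb k (by omega)
    have h2 := h.2.2.2.1 (a + k) b (by omega) hb
    rw [show a + (k+1) = a + k + 1 by omega]; omega

lemma syt_mono (h : IsSYT d w E) {a b a' b' : ℕ} (ha' : a' < d) (hb' : b' < w)
    (h1 : a ≤ a') (h2 : b ≤ b') : E a b + (a' - a) + (b' - b) ≤ E a' b' := by
  have e1 := syt_col h (a := a) (b := b) (by omega) (a' - a) (by omega)
  have e2 := syt_row h (a := a') (b := b) ha' (b' - b) (by omega)
  rw [show a + (a' - a) = a' by omega] at e1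
  rw [show b + (b' - b) = b' by omega] at e2
  omega

lemma syt_ge (h : IsSYT d w E) {a b : ℕ} (ha : a < d) (hb : b < w) : a + b + 1 ≤ E a b := by
  have h1 := syt_mono h ha hb (Nat.zero_le a) (Nat.zero_le b)
  have h2 := h.2.1 0 0 (by omega) (by omega)
  omega

/-- box containing the entry `k+1` -/
noncomputable def bx (d w : ℕ) (E : ℕ → ℕ → ℕ) (k : ℕ) : ℕ × ℕ :=
  open Classical in
  if h : ∃ p : ℕ × ℕ, p.1 < d ∧ p.2 < w ∧ E p.1 p.2 = k + 1 then h.choose else (0, 0)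

/-- content sequence -/
noncomputable def cont (d w : ℕ) (E : ℕ → ℕ → ℕ) (k : ℕ) : ℤ :=
  ((bx d w E k).2 : ℤ) - ((bx d w E k).1 : ℤ)

lemma cont_eq (h : IsSYT d w E) {a b k : ℕ} (ha : a < d) (hb : b < w) (e : E a b = k + 1) :
    cont d w E k = (b : ℤ) - a := by
  have hx : ∃ p : ℕ × ℕ, p.1 < d ∧ p.2 < w ∧ E p.1 p.2 = k + 1 := ⟨(a, b), ha, hb, e⟩
  have h1 : bx d w E k = hx.choose := by unfold bx; rw [dif_pos hx]
  have h2 := hx.choose_spec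
  rw [← h1] at h2
  obtain ⟨h3, h4⟩ := syt_inj h ha hb h2.1 h2.2.1 (by rw [e, h2.2.2])
  unfold cont
  rw [← h3, ← h4]

lemma cont_out (h : IsSYT d w E) {k : ℕ} (hk : d * w ≤ k) : cont d w E k = 0 := by
  have h1 : bx d w E k = (0, 0) := by
    unfold bx
    rw [dif_neg]
    rintro ⟨p, hp1, hp2, hp3⟩
    have := h.2.1 _ _ hp1 hp2
    omega
  unfold cont; rw [h1]; simp

lemma ex_box (h : IsSYT d w E) {k : ℕ} (hk : k < d * w) :
    ∃ a b, a < d ∧ b < w ∧ E a b = k + 1 ∧ cont d w E k = (b : ℤ) - a := by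
  obtain ⟨a, b, ha, hb, e⟩ := h.2.2.2.2 (k+1) (by omega) (by omega)
  exact ⟨a, b, ha, hb, e, cont_eq h ha hb e⟩

lemma cont_inj (h : IsSYT d w E) (h' : IsSYT d w E') (e : cont d w E = cont d w E') : E = E' := by
  have key : ∀ k, ∀ a b, a < d → b < w → (E a b = k + 1 ∨ E' a b = k + 1) → E a b = E' a b := by
    intro k
    induction k using Nat.strong_induction_on with
    | _ k ih =>
      have main : ∃ a b, a < d ∧ b < w ∧ E a b = k + 1 ∧ E' a b = k + 1 ∨ d * w ≤ k := by
        by_cases hk : k < d * w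
        swap
        · exact ⟨0, 0, Or.inr (by omega)⟩
        obtain ⟨a, b, ha, hb, e1, e2⟩ := ex_box h hk
        obtain ⟨a', b', ha', hb', e1', e2'⟩ := ex_box h' hk
        rw [e] at e2
        have hd : (b : ℤ) - a = b' - a' := by rw [← e2, ← e2']
        rcases lt_trichotomy a a' with hl | hl | hl
        · have h1 := syt_mono h' ha' hb' (a := a) (b := b) (by omega) (by omega)
          have h2 := h'.2.1 a b ha hb
          have := ih (E' a b - 1) (by omega) a b ha hb (by omega)
          omega
        · have : b = b' := by omega
          subst hl; subst this
          exact ⟨a, b, Or.inl ⟨ha, hb, e1, e1'⟩⟩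
        · have h1 := syt_mono h ha hb (a := a') (b := b') (by omega) (by omega)
          have h2 := h.2.1 a' b' ha' hb'
          have := ih (E a' b' - 1) (by omega) a' b' ha' hb' (by omega)
          omega
      intro a b ha hb hab
      obtain ⟨a', b', ⟨ha', hb', e1, e2⟩ | hk⟩ := main
      · rcases hab with hab | hab
        · obtain ⟨rfl, rfl⟩ := syt_inj h ha hb ha' hb' (by omega)
          omega
        · obtain ⟨rfl, rfl⟩ := syt_inj h' ha hb ha' hb' (by omega)
          omega
      · have h1 := h.2.1 a b ha hb
        have h2 := h'.2.1 a b ha hb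
        omega
  funext a b
  by_cases hab : a < d ∧ b < w
  · have h1 := h.2.1 a b hab.1 hab.2
    exact key (E a b - 1) a b hab.1 hab.2 (by omega)
  · rw [h.1 a b (by omega), h'.1 a b (by omega)]

lemma cont_good (h : IsSYT d w E) : Good (d*w) (cont d w E) := by
  constructor
  · intro k l hkl hl e
    obtain ⟨a, b, ha, hb, e1, e2⟩ := ex_box h (show k < d*w by omega)
    obtain ⟨a', b', ha', hb', e1', e2'⟩ := ex_box h hl
    have hlt : a < a' := by
      by_contra hc
      have := syt_mono h ha hb (a := a') (b := b') (by omega) (by omega)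
      omega
    have m1 := syt_mono h (a := a) (b := b) (a' := a) (b' := b+1) ha (by omega) (by omega) (by omega)
    have m2 := syt_mono h (a := a) (b := b+1) ha' hb' (by omega) (by omega)
    have h3 := cont_eq h (a := a) (b := b+1) (k := E a (b+1) - 1) ha (by omega) (by omega)
    refine ⟨E a (b+1) - 1, by omega, by omega, ?_⟩
    push_cast at h3; omega
  · intro k l hkl hl e
    obtain ⟨a, b, ha, hb, e1, e2⟩ := ex_box h (show k < d*w by omega)
    obtain ⟨a', b', ha', hb', e1', e2'⟩ := ex_box h hl
    have hlt : a < a' := by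
      by_contra hc
      have := syt_mono h ha hb (a := a') (b := b') (by omega) (by omega)
      omega
    have m1 := syt_mono h (a := a) (b := b) (a' := a+1) (b' := b) (by omega) (by omega) (by omega) (by omega)
    have m2 := syt_mono h (a := a+1) (b := b) ha' hb' (by omega) (by omega)
    have h3 := cont_eq h (a := a+1) (b := b) (k := E (a+1) b - 1) (by omega) (by omega) (by omega)
    refine ⟨E (a+1) b - 1, by omega, by omega, ?_⟩
    push_cast at h3; omega
  · intro k hk hp
    obtain ⟨a, b, ha, hb, e1, e2⟩ := ex_box h hk
    have m1 := syt_mono h (a := a) (b := b-1) ha hb (by omega) (by omega)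
    have h2 := h.2.1 a (b-1) ha (by omega)
    have h3 := cont_eq h (a := a) (b := b-1) (k := E a (b-1) - 1) (by omega) (by omega) (by omega)
    exact ⟨E a (b-1) - 1, by omega, by omega⟩
  · intro k hk hp
    obtain ⟨a, b, ha, hb, e1, e2⟩ := ex_box h hk
    have m1 := syt_mono h (a := a-1) (b := b) ha hb (by omega) (by omega)
    have h2 := h.2.1 (a-1) b (by omega) (by omega)
    have h3 := cont_eq h (a := a-1) (b := b) (k := E (a-1) b - 1) (by omega) (by omega) (by omega)
    exact ⟨E (a-1) b - 1, by omega, by omega⟩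

/-- swap of the entries `i+1` and `i+2` -/
def swE (i : ℕ) (E : ℕ → ℕ → ℕ) : ℕ → ℕ → ℕ := fun a b =>
  if E a b = i + 1 then i + 2 else if E a b = i + 2 then i + 1 else E a b

lemma swE_syt (h : IsSYT d w E) {i : ℕ} (hi : i + 1 < d * w)
    (hn : ¬ (cont d w E i - cont d w E (i+1) = 1 ∨ cont d w E (i+1) - cont d w E i = 1)) :
    IsSYT d w (swE i E) := by
  refine ⟨?_, ?_, ?_, ?_, ?_⟩
  · intro a b hab
    simp [swE, h.1 a b hab]
  · intro a b ha hb
    have := h.2.1 a b ha hb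
    unfold swE
    split_ifs <;> omega
  · intro a b ha hb
    have := h.2.2.1 a b ha hb
    unfold swE
    by_cases hc : E a b = i + 1 ∧ E a (b+1) = i + 2
    · have h1 := cont_eq h ha (by omega) hc.1
      have h2 := cont_eq h ha (by omega) hc.2
      push_cast at h2
      omega
    · split_ifs <;> omega
  · intro a b ha hb
    have := h.2.2.2.1 a b ha hb
    unfold swE
    by_cases hc : E a b = i + 1 ∧ E (a+1) b = i + 2
    · have h1 := cont_eq h (by omega) hb hc.1
      have h2 := cont_eq h ha (by omega) hc.2
      push_cast at h2
      omega
    · split_ifs <;> omega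
  · intro m h1 h2
    by_cases m1 : m = i + 1
    · obtain ⟨a, b, ha, hb, e⟩ := h.2.2.2.2 (i+2) (by omega) (by omega)
      exact ⟨a, b, ha, hb, by simp [swE, e, m1]⟩
    by_cases m2 : m = i + 2
    · obtain ⟨a, b, ha, hb, e⟩ := h.2.2.2.2 (i+1) (by omega) (by omega)
      exact ⟨a, b, ha, hb, by simp [swE, e, m2]⟩
    obtain ⟨a, b, ha, hb, e⟩ := h.2.2.2.2 m (by omega) (by omega)
    exact ⟨a, b, ha, hb, by simp [swE, e, m1, m2]⟩

lemma swE_cont (h : IsSYT d w E) {i : ℕ} (hi : i + 1 < d * w)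
    (hn : ¬ (cont d w E i - cont d w E (i+1) = 1 ∨ cont d w E (i+1) - cont d w E i = 1)) :
    cont d w (swE i E) = cont d w E ∘ Equiv.swap i (i+1) := by
  have h' := swE_syt h hi hn
  funext k
  rw [swap_ap]
  by_cases hk : k < d * w
  · obtain ⟨a, b, ha, hb, e1, e2⟩ := ex_box h' hk
    rw [e2]
    unfold swE at e1
    split_ifs with k1 k2
    · rw [cont_eq h ha hb]
      split_ifs at e1 <;> omega
    · rw [cont_eq h ha hb]
      split_ifs at e1 <;> omega
    · rw [cont_eq h ha hb]
      split_ifs at e1 <;> omega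
  · rw [cont_out h' (by omega), if_neg (by omega), if_neg (by omega), cont_out h (by omega)]

/-- toggle on tableaux -/
noncomputable def togE (d w i : ℕ) (E : ℕ → ℕ → ℕ) : ℕ → ℕ → ℕ :=
  if cont d w E i - cont d w E (i+1) = 1 ∨ cont d w E (i+1) - cont d w E i = 1 then E else swE i E

lemma togE_syt (h : IsSYT d w E) {i : ℕ} (hi : i + 1 < d * w) : IsSYT d w (togE d w i E) := by
  unfold togE
  split_ifs with hc
  · exact h
  · exact swE_syt h hi hc

lemma togE_cont (h : IsSYT d w E) {i : ℕ} (hi : i + 1 < d * w) :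
    cont d w (togE d w i E) = tg i (cont d w E) := by
  unfold togE tg
  split_ifs with hc
  · rfl
  · exact swE_cont h hi hc

/-- all content sequences -/
def VV (d w : ℕ) : Set (ℕ → ℤ) := {f | ∃ E, IsSYT d w E ∧ cont d w E = f}

lemma VV_good : ∀ f ∈ VV d w, Good (d*w) f := by
  rintro f ⟨E, h, rfl⟩
  exact cont_good h

lemma VV_cl : ∀ f ∈ VV d w, ∀ i, i + 1 < d * w → tg i f ∈ VV d w := by
  rintro f ⟨E, h, rfl⟩ i hi
  exact ⟨_, togE_syt h hi, togE_cont h hi⟩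
end C
end S14

namespace S14

section L
variable {d w : ℕ} {E E' : ℕ → ℕ → ℕ}

lemma step_cases (h : IsSYT d w E) (k : ℕ) (p : ℕ × ℕ) (h1 : p.1 < d) (h2 : p.2 < w) :
    (slideStep d w k E p = p ∧ (p.1 + 1 < d → k < E (p.1+1) p.2) ∧ (p.2 + 1 < w → k < E p.1 (p.2+1))) ∨
    (slideStep d w k E p = (p.1+1, p.2) ∧ p.1 + 1 < d ∧ E (p.1+1) p.2 ≤ k ∧
      (p.2 + 1 < w → E (p.1+1) p.2 < E p.1 (p.2+1))) ∨
    (slideStep d w k E p = (p.1, p.2+1) ∧ p.2 + 1 < w ∧ E p.1 (p.2+1) ≤ k ∧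
      (p.1 + 1 < d → E p.1 (p.2+1) < E (p.1+1) p.2)) := by
  unfold slideStep
  split_ifs with c1 c2 c3 c4
  · exact Or.inr (Or.inl ⟨rfl, c1.1.1, c1.1.2, fun _ => c2⟩)
  · refine Or.inr (Or.inr ⟨rfl, c1.2.1, c1.2.2, fun hp => ?_⟩)
    have : E p.1 (p.2+1) ≠ E (p.1+1) p.2 := by
      intro e
      have := syt_inj h h1 c1.2.1 hp h2 e
      omega
    omega
  · exact Or.inr (Or.inl ⟨rfl, c3.1, c3.2, fun hp => by
      by_contra hc
      exact c1 ⟨c3, hp, by omega⟩⟩)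
  · exact Or.inr (Or.inr ⟨rfl, c4.1, c4.2, fun hp => by
      by_contra hc
      exact c3 ⟨hp, by omega⟩⟩)
  · refine Or.inl ⟨rfl, fun hp => ?_, fun hp => ?_⟩
    · by_contra hc
      exact c3 ⟨hp, by omega⟩
    · by_contra hc
      exact c4 ⟨hp, by omega⟩

lemma step_succ_ne (h : IsSYT d w E) (k : ℕ) (p : ℕ × ℕ) (h1 : p.1 < d) (h2 : p.2 < w)
    (hne : slideStep d w k E p ≠ p) : slideStep d w (k+1) E p = slideStep d w k E p := by
  rcases step_cases h k p h1 h2 with ⟨a1, a2, a3⟩ | ⟨a1, a2, a3, a4⟩ | ⟨a1, a2, a3, a4⟩ <;>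
  rcases step_cases h (k+1) p h1 h2 with ⟨b1, b2, b3⟩ | ⟨b1, b2, b3, b4⟩ | ⟨b1, b2, b3, b4⟩
  · exact absurd a1 hne
  · exact absurd a1 hne
  · exact absurd a1 hne
  · have := b2 a2; omega
  · rw [a1, b1]
  · have := b4 a2; have := a4 b2; omega
  · have := b3 a2; omega
  · have := b4 a2; have := a4 b2; omega
  · rw [a1, b1]

lemma step_succ_eq (h : IsSYT d w E) (k : ℕ) (p B : ℕ × ℕ) (h1 : p.1 < d) (h2 : p.2 < w)
    (hB1 : B.1 < d) (hB2 : B.2 < w) (hB : E B.1 B.2 = k + 1)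
    (hst : slideStep d w k E p = p) :
    (slideStep d w (k+1) E p = B ∧ (B = (p.1+1, p.2) ∨ B = (p.1, p.2+1))) ∨
    (slideStep d w (k+1) E p = p ∧ B ≠ (p.1+1, p.2) ∧ B ≠ (p.1, p.2+1)) := by
  rcases step_cases h k p h1 h2 with ⟨a1, a2, a3⟩ | ⟨a1, a2, a3, a4⟩ | ⟨a1, a2, a3, a4⟩
  · rcases step_cases h (k+1) p h1 h2 with ⟨b1, b2, b3⟩ | ⟨b1, b2, b3, b4⟩ | ⟨b1, b2, b3, b4⟩
    · refine Or.inr ⟨b1, ?_, ?_⟩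
      · rintro rfl
        have := b2 hB1
        simp only at hB
        omega
      · rintro rfl
        have := b3 hB2
        simp only at hB
        omega
    · have := a2 b2
      have e := syt_inj h b2 h2 hB1 hB2 (by omega)
      have e2 : B = (p.1+1, p.2) := Prod.ext e.1.symm e.2.symm
      exact Or.inl ⟨by rw [b1, e2], Or.inl e2⟩
    · have := a3 b2
      have e := syt_inj h h1 b2 hB1 hB2 (by omega)
      have e2 : B = (p.1, p.2+1) := Prod.ext e.1.symm e.2.symm
      exact Or.inl ⟨by rw [b1, e2], Or.inr e2⟩
  · rw [a1] at hst
    have := congrArg Prod.fst hst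
    simp at this
  · rw [a1] at hst
    have := congrArg Prod.snd hst
    simp at this

lemma path_const (k s : ℕ) (q : ℕ × ℕ) (h1 : slidePath d w k E s = q) (h2 : slideStep d w k E q = q) :
    ∀ m, s ≤ m → slidePath d w k E m = q := by
  intro m hm
  induction m, hm using Nat.le_induction with
  | base => exact h1
  | succ m hm ih => rw [slidePath, ih, h2]

lemma path_in (h : IsSYT d w E) (hd : 0 < d) (hw : 0 < w) (h0 : E 0 0 = 1) (k : ℕ) (hk : 1 ≤ k) : ∀ m,
    (slidePath d w k E m).1 < d ∧ (slidePath d w k E m).2 < w ∧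
      E (slidePath d w k E m).1 (slidePath d w k E m).2 ≤ k
  | 0 => ⟨hd, hw, by rw [slidePath, h0]; exact hk⟩
  | m + 1 => by
    obtain ⟨i1, i2, i3⟩ := path_in h hd hw h0 k hk m
    rw [slidePath]
    rcases step_cases h k _ i1 i2 with ⟨a1, a2, a3⟩ | ⟨a1, a2, a3, a4⟩ | ⟨a1, a2, a3, a4⟩
    · rw [a1]; exact ⟨i1, i2, i3⟩
    · rw [a1]; exact ⟨a2, i2, a3⟩
    · rw [a1]; exact ⟨i1, a2, a3⟩

lemma path_spec (h : IsSYT d w E) (hd : 0 < d) (hw : 0 < w) (h0 : E 0 0 = 1) (k : ℕ) (hk : 1 ≤ k) :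
    ∃ s q, s < k ∧ q.1 + q.2 = s ∧
      (∀ m, m ≤ s → (slidePath d w k E m).1 + (slidePath d w k E m).2 = m) ∧
      (∀ m, m < s → slideStep d w k E (slidePath d w k E m) ≠ slidePath d w k E m) ∧
      (∀ m, s ≤ m → slidePath d w k E m = q) ∧ slideStep d w k E q = q := by
  have hin := path_in h hd hw h0 k hk
  have hsum : ∀ t, (∀ m, m < t → slideStep d w k E (slidePath d w k E m) ≠ slidePath d w k E m) →
      ∀ m, m ≤ t → (slidePath d w k E m).1 + (slidePath d w k E m).2 = m := by
    intro t ht m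
    induction m with
    | zero => intro _; rfl
    | succ m ih =>
      intro hm
      have h1 := ih (by omega)
      rw [slidePath]
      rcases step_cases h k _ (hin m).1 (hin m).2.1 with ⟨a1, a2, a3⟩ | ⟨a1, a2, a3, a4⟩ | ⟨a1, a2, a3, a4⟩
      · exact absurd a1 (ht m (by omega))
      · rw [a1]; simp only; omega
      · rw [a1]; simp only; omega
  have hex : ∃ m, m < k ∧ slideStep d w k E (slidePath d w k E m) = slidePath d w k E m := by
    by_contra hc
    push Not at hc
    have h1 := hsum k hc k le_rfl
    have h2 := hin k
    have h3 := syt_ge h h2.1 h2.2.1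
    omega
  classical
  have hs := Nat.find_spec hex
  have hm : ∀ m, m < Nat.find hex → slideStep d w k E (slidePath d w k E m) ≠ slidePath d w k E m := by
    intro m hm
    have := Nat.find_min hex hm
    intro e
    exact this ⟨by omega, e⟩
  have hsm := hsum _ hm
  exact ⟨Nat.find hex, slidePath d w k E (Nat.find hex), hs.1, hsm _ le_rfl, hsm, hm,
    path_const k _ _ rfl hs.2, hs.2⟩

lemma adj_right (h : IsSYT d w E) {a b a' b' k : ℕ} (ha : a < d) (hb : b < w) (ha' : a' < d) (hb' : b' < w)
    (e : E a b = k) (e' : E a' b' = k + 1) (hc : (b' : ℤ) - a' = b - a + 1) : a' = a ∧ b' = b + 1 := by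
  rcases lt_or_ge a' a with hl | hl
  · have := syt_mono h ha hb (a := a') (b := b') (by omega) (by omega)
    omega
  · have := syt_mono h ha' hb' (a := a) (b := b) (by omega) (by omega)
    omega

lemma adj_down (h : IsSYT d w E) {a b a' b' k : ℕ} (ha : a < d) (hb : b < w) (ha' : a' < d) (hb' : b' < w)
    (e : E a b = k) (e' : E a' b' = k + 1) (hc : (b' : ℤ) - a' = b - a - 1) : a' = a + 1 ∧ b' = b := by
  rcases lt_or_ge b' b with hl | hl
  · have := syt_mono h ha hb (a := a') (b := b') (by omega) (by omega)
    omega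
  · have := syt_mono h ha' hb' (a := a) (b := b) (by omega) (by omega)
    omega

lemma pp_one (h : IsSYT d w E) (hd : 0 < d) (hw : 0 < w) (h0 : E 0 0 = 1) : partialPromo d w 1 E = E := by
  have hst : slideStep d w 1 E (0, 0) = (0, 0) := by
    have g1 : 0 + 1 < d → 2 ≤ E (0+1) 0 := fun hp => by
      have := syt_ge h hp hw; omega
    have g2 : 0 + 1 < w → 2 ≤ E 0 (0+1) := fun hp => by
      have := syt_ge h hd hp; omega
    rcases step_cases h 1 (0, 0) hd hw with ⟨a1, a2, a3⟩ | ⟨a1, a2, a3, a4⟩ | ⟨a1, a2, a3, a4⟩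
    · exact a1
    · have := g1 a2; simp only at a3; omega
    · have := g2 a2; simp only at a3; omega
  have hp : ∀ m, slidePath d w 1 E m = (0, 0) := fun m => path_const 1 0 (0, 0) rfl hst m (by omega)
  funext i j
  unfold partialPromo
  rw [hp, hp]
  split_ifs with c1 c2 c3 c4
  · rw [h.1 i j c1]
  · simp only [Prod.mk.injEq] at c2
    rw [c2.1, c2.2, h0]
  · exact absurd c3.symm c2
  · have g := syt_ge h (a := i) (b := j) (by omega) (by omega)
    exfalso
    apply c2
    ext <;> simp only <;> omega
  · rfl

lemma pp_succ (h : IsSYT d w E) (hd : 0 < d) (hw : 0 < w) (h0 : E 0 0 = 1) (k : ℕ) (hkN : k + 2 ≤ d * w)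
    (h1 : IsSYT d w (partialPromo d w (k+1) E)) :
    partialPromo d w (k+2) E = togE d w k (partialPromo d w (k+1) E) := by
  obtain ⟨s, q, hs, hqs, hsum, hne, hcon, hst⟩ := path_spec h hd hw h0 (k+1) (by omega)
  have hin := path_in h hd hw h0 (k+1) (by omega)
  obtain ⟨x, y, hx, hy, hB⟩ := h.2.2.2.2 (k+2) (by omega) hkN
  have hq := hin s
  rw [hcon s le_rfl] at hq
  have hP : ∀ m, m ≤ s → slidePath d w (k+2) E m = slidePath d w (k+1) E m := by
    intro m
    induction m with
    | zero => intro _; rfl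
    | succ m ih =>
      intro hm
      rw [slidePath, slidePath, ih (by omega)]
      exact step_succ_ne h (k+1) _ (hin m).1 (hin m).2.1 (hne m (by omega))
  have hPs : slidePath d w (k+2) E s = q := by rw [hP s le_rfl, hcon s le_rfl]
  -- values of the smaller promotion
  have vq : partialPromo d w (k+1) E q.1 q.2 = k + 1 := by
    unfold partialPromo
    rw [if_neg (by omega), hcon (k+1) (by omega), if_pos rfl]
  have vbig : ∀ i j, i < d → j < w → k + 1 < E i j → partialPromo d w (k+1) E i j = E i j := by
    intro i j hi hj hE
    unfold partialPromo
    rw [if_neg (by omega), if_neg, if_neg, if_neg (by omega)]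
    · intro e
      have := (hin (i+j)).2.2
      rw [e] at this
      simp only at this
      omega
    · intro e
      have := (hin (k+1)).2.2
      rw [← e] at this
      simp only at this
      omega
  have vB := vbig x y hx hy (by omega)
  rw [hB] at vB
  have cq := cont_eq h1 hq.1 hq.2.1 vq
  have cB := cont_eq h1 hx hy vB
  have hBq : ∀ i j, i < d → j < w → E i j = k + 2 → i = x ∧ j = y := fun i j hi hj e =>
    syt_inj h hi hj hx hy (by omega)
  rcases step_succ_eq h (k+1) q (x, y) hq.1 hq.2.1 hx hy hB hst with ⟨e1, e2⟩ | ⟨e1, e2, e3⟩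
  · -- adjacent case
    have ht : togE d w k (partialPromo d w (k+1) E) = partialPromo d w (k+1) E := by
      unfold togE
      rw [if_pos]
      rw [cq, cB]
      rcases e2 with e2 | e2 <;> simp only [Prod.mk.injEq] at e2
      · obtain ⟨rfl, rfl⟩ := e2; push_cast; omega
      · obtain ⟨rfl, rfl⟩ := e2; push_cast; omega
    rw [ht]
    have hP1 : slidePath d w (k+2) E (s+1) = (x, y) := by rw [slidePath, hPs, e1]
    have hstB : slideStep d w (k+2) E (x, y) = (x, y) := by
      rcases step_cases h (k+2) (x, y) hx hy with ⟨a1, a2, a3⟩ | ⟨a1, a2, a3, a4⟩ | ⟨a1, a2, a3, a4⟩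
      · exact a1
      · have := h.2.2.2.1 x y a2 hy; simp only at a3; omega
      · have := h.2.2.1 x y hx a2; simp only at a3; omega
    have hPB := path_const (k+2) (s+1) (x, y) hP1 hstB
    funext i j
    by_cases hout : d ≤ i ∨ w ≤ j
    · rw [h1.1 i j hout]; unfold partialPromo; rw [if_pos hout]
    by_cases hijB : (i, j) = (x, y)
    · simp only [Prod.mk.injEq] at hijB
      obtain ⟨rfl, rfl⟩ := hijB
      rw [vB]
      unfold partialPromo
      rw [if_neg hout, hPB (k+2) (by omega), if_pos rfl]
    by_cases hijq : (i, j) = q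
    · have vq' := vq
      rw [← hijq] at vq'
      simp only at vq'
      rw [vq']
      unfold partialPromo
      have hij : i + j = s := by rw [← hqs, ← hijq]
      rw [if_neg hout, hPB (k+2) (by omega), if_neg hijB, hij, hPs, if_pos hijq.symm, hP1]
      simp only [hB]
      omega
    unfold partialPromo
    rw [if_neg hout, if_neg hout, hPB (k+2) (by omega), if_neg hijB, hcon (k+1) (by omega), if_neg hijq]
    have hEne : E i j ≠ k + 2 := by
      intro e
      obtain ⟨rfl, rfl⟩ := hBq i j (by omega) (by omega) e
      exact hijB rfl
    rcases lt_or_ge (i+j) s with hl | hl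
    · rw [hP (i+j) (by omega), hP (i+j+1) (by omega)]
      split_ifs <;> omega
    · rw [hcon (i+j) hl, if_neg (c := q = (i, j)) (fun e => hijq e.symm)]
      have : slidePath d w (k+2) E (i+j) ≠ (i, j) := by
        rcases Nat.eq_or_lt_of_le hl with e | e
        · rw [← e, hPs]; exact fun e => hijq e.symm
        · rw [hPB _ (by omega)]; exact fun e => hijB e.symm
      rw [if_neg this]
      split_ifs <;> omega
  · -- nonadjacent case
    have ht : togE d w k (partialPromo d w (k+1) E) = swE k (partialPromo d w (k+1) E) := by
      unfold togE
      rw [if_neg]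
      rw [cq, cB]
      rintro (hc | hc)
      · obtain ⟨r1, r2⟩ := adj_down h1 hq.1 hq.2.1 hx hy vq vB (by omega)
        exact e2 (by rw [r1, r2])
      · obtain ⟨r1, r2⟩ := adj_right h1 hq.1 hq.2.1 hx hy vq vB (by omega)
        exact e3 (by rw [r1, r2])
    rw [ht]
    have hcon2 := path_const (k+2) s q hPs e1
    have hPall : ∀ m, slidePath d w (k+2) E m = slidePath d w (k+1) E m := by
      intro m
      rcases le_total m s with hm | hm
      · exact hP m hm
      · rw [hcon2 m hm, hcon m hm]
    funext i j
    by_cases hout : d ≤ i ∨ w ≤ j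
    · unfold swE
      rw [h1.1 i j hout]; unfold partialPromo; rw [if_pos hout]; simp
    by_cases hijB : (i, j) = (x, y)
    · simp only [Prod.mk.injEq] at hijB
      obtain ⟨rfl, rfl⟩ := hijB
      have v : swE k (partialPromo d w (k+1) E) i j = k + 1 := by
        unfold swE; rw [vB]; simp
      rw [v]
      have nB : ∀ m, slidePath d w (k+1) E m ≠ (i, j) := by
        intro m e
        have := (hin m).2.2
        rw [e] at this
        simp only at this
        omega
      unfold partialPromo
      rw [if_neg hout, hPall, hPall, if_neg (fun e => nB _ e.symm), if_neg (nB _), if_pos (by omega), hB]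
      omega
    by_cases hijq : (i, j) = q
    · have vq' := vq
      rw [← hijq] at vq'
      simp only at vq'
      have v : swE k (partialPromo d w (k+1) E) i j = k + 2 := by
        unfold swE; rw [vq']; simp
      rw [v]
      unfold partialPromo
      rw [if_neg hout, hcon2 (k+2) (by omega), if_pos hijq]
    have n1 : partialPromo d w (k+1) E i j ≠ k + 1 := by
      intro e
      have := syt_inj h1 (a := i) (b := j) (by omega) (by omega) hq.1 hq.2.1 (by rw [e, vq])
      exact hijq (Prod.ext this.1 this.2)
    have n2 : partialPromo d w (k+1) E i j ≠ k + 2 := by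
      intro e
      obtain ⟨rfl, rfl⟩ := syt_inj h1 (a := i) (b := j) (by omega) (by omega) hx hy (by rw [e, vB])
      exact hijB rfl
    have hEne : E i j ≠ k + 2 := by
      intro e
      obtain ⟨rfl, rfl⟩ := hBq i j (by omega) (by omega) e
      exact hijB rfl
    have v : swE k (partialPromo d w (k+1) E) i j = partialPromo d w (k+1) E i j := by
      unfold swE; rw [if_neg n1, if_neg n2]
    rw [v]
    unfold partialPromo
    rw [if_neg hout, if_neg hout, hPall, hPall, hPall, hcon (k+1) (by omega), hcon (k+2) (by omega)]
    split_ifs <;> omega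

lemma syt_00 (h : IsSYT d w E) (hd : 0 < d) (hw : 0 < w) : E 0 0 = 1 := by
  have : 0 < d * w := Nat.mul_pos hd hw
  obtain ⟨a, b, ha, hb, e⟩ := h.2.2.2.2 1 le_rfl (by omega)
  have := syt_ge h ha hb
  have h1 : a = 0 := by omega
  have h2 : b = 0 := by omega
  subst h1; subst h2; exact e

lemma pp_cont (h : IsSYT d w E) (hd : 0 < d) (hw : 0 < w) : ∀ k, k + 1 ≤ d * w →
    IsSYT d w (partialPromo d w (k+1) E) ∧ cont d w (partialPromo d w (k+1) E) = J k (cont d w E)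
  | 0, _ => by
    rw [zero_add, pp_one h hd hw (syt_00 h hd hw)]
    exact ⟨h, rfl⟩
  | k + 1, hk => by
    obtain ⟨i1, i2⟩ := pp_cont h hd hw k (by omega)
    rw [pp_succ h hd hw (syt_00 h hd hw) k hk i1]
    refine ⟨togE_syt i1 (by omega), ?_⟩
    rw [togE_cont i1 (by omega), i2]
    rfl

lemma ev_cont (hd : 0 < d) (hw : 0 < w) : ∀ k, k + 1 ≤ d * w → ∀ E, IsSYT d w E → 
    IsSYT d w (evacAux d w (k+1) E) ∧ cont d w (evacAux d w (k+1) E) = Ev k (cont d w E)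
  | 0, _, E, h => by
    have : evacAux d w (0+1) E = E := by
      rw [evacAux, evacAux, zero_add, pp_one h hd hw (syt_00 h hd hw)]
    rw [this]
    exact ⟨h, rfl⟩
  | k + 1, hk, E, h => by
    obtain ⟨i1, i2⟩ := pp_cont h hd hw (k+1) hk
    obtain ⟨j1, j2⟩ := ev_cont hd hw k (by omega) _ i1
    rw [evacAux]
    exact ⟨j1, by rw [j2, i2]; rfl⟩

lemma evac_cont (h : IsSYT d w E) (hd : 0 < d) (hw : 0 < w) :
    IsSYT d w (evac d w E) ∧ cont d w (evac d w E) = Ev (d*w-1) (cont d w E) := by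
  have : 0 < d * w := Nat.mul_pos hd hw
  have h1 := ev_cont hd hw (d*w-1) (by omega) E h
  rw [show d*w-1+1 = d*w by omega] at h1
  exact h1

lemma promo_cont (h : IsSYT d w E) (hd : 0 < d) (hw : 0 < w) :
    IsSYT d w (promo d w E) ∧ cont d w (promo d w E) = J (d*w-1) (cont d w E) := by
  have : 0 < d * w := Nat.mul_pos hd hw
  have h1 := pp_cont h hd hw (d*w-1) (by omega)
  rw [show d*w-1+1 = d*w by omega] at h1
  exact h1

lemma promo_iter (h : IsSYT d w E) (hd : 0 < d) (hw : 0 < w) (m : ℕ) :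
    IsSYT d w ((promo d w)^[m] E) ∧ cont d w ((promo d w)^[m] E) = (J (d*w-1) ^ m) (cont d w E) := by
  induction m with
  | zero => exact ⟨h, rfl⟩
  | succ m ih =>
    rw [Function.iterate_succ_apply']
    obtain ⟨i1, i2⟩ := promo_cont ih.1 hd hw
    refine ⟨i1, ?_⟩
    rw [i2, ih.2, pow_succ']
    rfl
end L
end S14

namespace S14

section T
variable {d w : ℕ} {E E' : ℕ → ℕ → ℕ}

/-- move the entry `k+1` up to `m+1` -/
def cyE (k m : ℕ) (E : ℕ → ℕ → ℕ) : ℕ → ℕ → ℕ := fun a b =>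
  if E a b = k + 1 then m + 1 else if k + 1 < E a b ∧ E a b ≤ m + 1 then E a b - 1 else E a b

lemma cyE_syt (h : IsSYT d w E) {k m : ℕ} (hkm : k ≤ m) (hm : m < d * w)
    (hn : ∀ l, k < l → l ≤ m → cont d w E l ≠ cont d w E k + 1 ∧ cont d w E l ≠ cont d w E k - 1) :
    IsSYT d w (cyE k m E) := by
  refine ⟨?_, ?_, ?_, ?_, ?_⟩
  · intro a b hab
    simp [cyE, h.1 a b hab]
  · intro a b ha hb
    have := h.2.1 a b ha hb
    unfold cyE
    split_ifs <;> omega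
  · intro a b ha hb
    have := h.2.2.1 a b ha hb
    unfold cyE
    by_cases hc : E a b = k + 1 ∧ E a (b+1) ≤ m + 1
    · have h1 := cont_eq h ha (by omega) hc.1
      have h2 := cont_eq h ha (k := E a (b+1) - 1) hb (by omega)
      have := hn (E a (b+1) - 1) (by omega) (by omega)
      push_cast at h2
      omega
    · split_ifs <;> omega
  · intro a b ha hb
    have := h.2.2.2.1 a b ha hb
    unfold cyE
    by_cases hc : E a b = k + 1 ∧ E (a+1) b ≤ m + 1
    · have h1 := cont_eq h (by omega) hb hc.1
      have h2 := cont_eq h ha (k := E (a+1) b - 1) hb (by omega)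
      have := hn (E (a+1) b - 1) (by omega) (by omega)
      push_cast at h2
      omega
    · split_ifs <;> omega
  · intro e h1 h2
    by_cases e1 : e = m + 1
    · obtain ⟨a, b, ha, hb, e⟩ := h.2.2.2.2 (k+1) (by omega) (by omega)
      exact ⟨a, b, ha, hb, by unfold cyE; rw [if_pos e, e1]⟩
    by_cases e2 : k + 1 ≤ e ∧ e < m + 1
    · obtain ⟨a, b, ha, hb, e⟩ := h.2.2.2.2 (e+1) (by omega) (by omega)
      exact ⟨a, b, ha, hb, by unfold cyE; split_ifs <;> omega⟩
    obtain ⟨a, b, ha, hb, e⟩ := h.2.2.2.2 e (by omega) (by omega)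
    exact ⟨a, b, ha, hb, by unfold cyE; split_ifs <;> omega⟩

/-- agreement above `m` -/
def Agr (m : ℕ) (E E' : ℕ → ℕ → ℕ) : Prop := ∀ a b, (m < E a b ∨ m < E' a b) → E a b = E' a b

lemma swE_val (i : ℕ) (E : ℕ → ℕ → ℕ) (u v : ℕ) : (E u v = i + 1 ∧ swE i E u v = i + 2) ∨
    (E u v = i + 2 ∧ swE i E u v = i + 1) ∨ (E u v ≠ i + 1 ∧ E u v ≠ i + 2 ∧ swE i E u v = E u v) := by
  unfold swE
  split_ifs <;> omega

lemma cyE_val (k m : ℕ) (E : ℕ → ℕ → ℕ) (u v : ℕ) : (E u v = k + 1 ∧ cyE k m E u v = m + 1) ∨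
    (k + 1 < E u v ∧ E u v ≤ m + 1 ∧ cyE k m E u v = E u v - 1) ∨
    ((E u v < k + 1 ∨ k + 1 < E u v ∧ m + 1 < E u v) ∧ cyE k m E u v = E u v) := by
  unfold cyE
  split_ifs <;> omega

lemma agr_a (k P : ℕ) (E : ℕ → ℕ → ℕ) (h : k ≤ P) : Agr (P+1) E (swE P (cyE k (P+1) E)) := by
  intro u v huv
  have h1 := cyE_val k (P+1) E u v
  have h2 := swE_val P (cyE k (P+1) E) u v
  omega

lemma agr_b (t i : ℕ) (E : ℕ → ℕ → ℕ) (h : t ≤ i) : Agr (i+1+1) E (cyE t i E) := by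
  intro u v huv
  have h1 := cyE_val t i E u v
  omega

lemma agr_c (t i : ℕ) (E : ℕ → ℕ → ℕ) (h : t ≤ i) :
    Agr (i+1+1) (swE (i+1) (cyE t i (swE (i+1) E))) E := by
  intro u v huv
  have h1 := swE_val (i+1) E u v
  have h2 := cyE_val t i (swE (i+1) E) u v
  have h3 := swE_val (i+1) (cyE t i (swE (i+1) E)) u v
  omega

lemma in_rect (h : IsSYT d w E) {a b : ℕ} (hp : 0 < E a b) : a < d ∧ b < w := by
  by_contra hc
  have := h.1 a b (by omega)
  omega

/-- intermediate content -/
lemma ex_between {N : ℕ} {f : ℕ → ℤ} (h : Good N f) {P : ℕ} (hP : P + 1 < N)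
    (hn : ¬ (f P - f (P+1) = 1 ∨ f (P+1) - f P = 1)) :
    ∃ t, t < P ∧ ((f P < f t ∧ f t < f (P+1)) ∨ (f (P+1) < f t ∧ f t < f P)) ∧
      ∀ l, t < l → l < P → f l ≠ f t + 1 ∧ f l ≠ f t - 1 := by
  have hne := h.ne1 P hP
  have hex : ∃ t, t < P ∧ ((f P < f t ∧ f t < f (P+1)) ∨ (f (P+1) < f t ∧ f t < f P)) := by
    rcases lt_or_gt_of_ne hne with hl | hl
    · rcases lt_or_ge 0 (f (P+1)) with h0 | h0
      · obtain ⟨m, m1, m2⟩ := h.pos (P+1) hP h0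
        have : m ≠ P := by rintro rfl; omega
        exact ⟨m, by omega, by omega⟩
      · obtain ⟨m, m1, m2⟩ := h.neg P (by omega) (by omega)
        exact ⟨m, by omega, by omega⟩
    · rcases lt_or_ge 0 (f P) with h0 | h0
      · obtain ⟨m, m1, m2⟩ := h.pos P (by omega) h0
        exact ⟨m, by omega, by omega⟩
      · obtain ⟨m, m1, m2⟩ := h.neg (P+1) hP (by omega)
        have : m ≠ P := by rintro rfl; omega
        exact ⟨m, by omega, by omega⟩
  classical
  obtain ⟨t0, ht0⟩ := hex
  let Q : ℕ → Prop := fun t => t < P ∧ ((f P < f t ∧ f t < f (P+1)) ∨ (f (P+1) < f t ∧ f t < f P))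
  have hQ : Q (Nat.findGreatest Q P) := Nat.findGreatest_spec (P := Q) (m := t0) (by omega) ht0
  have hmax : ∀ l, Nat.findGreatest Q P < l → l < P → ¬ Q l := fun l h1 h2 =>
    Nat.findGreatest_is_greatest h1 (by omega)
  generalize Nat.findGreatest Q P = t at hQ hmax
  refine ⟨t, hQ.1, hQ.2, ?_⟩
  have hmax' : ∀ l, t < l → l < P →
      ¬ ((f P < f l ∧ f l < f (P+1)) ∨ (f (P+1) < f l ∧ f l < f P)) := fun l h1 h2 h3 =>
    hmax l h1 h2 ⟨h2, h3⟩
  obtain ⟨hQ1, hQ2⟩ := hQ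
  -- no occurrences of the two end contents after `t`
  have n1 : ∀ l, t < l → l < P → f l ≠ f P := by
    intro l h1 h2 e
    obtain ⟨m, m1, m2, m3⟩ := h.up l P h2 (by omega) e
    obtain ⟨m', m1', m2', m3'⟩ := h.dn l P h2 (by omega) e
    have := hmax' m (by omega) (by omega)
    have := hmax' m' (by omega) (by omega)
    omega
  have n2 : ∀ l, t < l → l < P → f l ≠ f (P+1) := by
    intro l h1 h2 e
    obtain ⟨m, m1, m2, m3⟩ := h.up l (P+1) (by omega) (by omega) e
    obtain ⟨m', m1', m2', m3'⟩ := h.dn l (P+1) (by omega) (by omega) e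
    have a1 : m ≠ P := by rintro rfl; omega
    have a2 : m' ≠ P := by rintro rfl; omega
    have := hmax' m (by omega) (by omega)
    have := hmax' m' (by omega) (by omega)
    omega
  intro l h1 h2
  have := n1 l h1 h2
  have := n2 l h1 h2
  have := hmax' l h1 h2
  omega

lemma trans_ind (S : (ℕ → ℤ) → Prop)
    (hS : ∀ f ∈ VV d w, ∀ i, i + 2 < d * w → S f → S (dk i f)) :
    ∀ m, m ≤ d * w → ∀ E E', IsSYT d w E → IsSYT d w E' → Agr m E E' → S (cont d w E) → S (cont d w E')
  | 0, _, E, E', h, h', hA, hs => by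
    have : E = E' := by
      funext a b
      by_cases hp : 0 < E a b ∨ 0 < E' a b
      · exact hA a b hp
      · omega
    rwa [← this]
  | M + 1, hM, E, E', h, h', hA, hs => by
    have ih := trans_ind S hS M (by omega)
    obtain ⟨a, b, ha, hb, eA⟩ := h.2.2.2.2 (M+1) (by omega) hM
    obtain ⟨x, y, hx, hy, eB⟩ := h'.2.2.2.2 (M+1) (by omega) hM
    have hle : E x y ≤ M + 1 := by
      by_contra hc
      have := hA x y (by omega)
      omega
    rcases Nat.eq_or_lt_of_le hle with heq | hlt
    · refine ih E E' h h' ?_ hs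
      intro u v huv
      by_cases hc : M + 1 < E u v ∨ M + 1 < E' u v
      · exact hA u v hc
      · rcases huv with huv | huv
        · obtain ⟨hu, hv⟩ := in_rect h (show 0 < E u v by omega)
          obtain ⟨rfl, rfl⟩ := syt_inj h hu hv hx hy (by omega)
          omega
        · obtain ⟨hu, hv⟩ := in_rect h' (show 0 < E' u v by omega)
          obtain ⟨rfl, rfl⟩ := syt_inj h' hu hv hx hy (by omega)
          omega
    have hpos := h.2.1 x y hx hy
    obtain ⟨k, hk⟩ : ∃ k, E x y = k + 1 := ⟨E x y - 1, by omega⟩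
    have ck := cont_eq h hx hy hk
    have hcorner : ∀ l, k < l → l ≤ M →
        cont d w E l ≠ cont d w E k + 1 ∧ cont d w E l ≠ cont d w E k - 1 := by
      intro l hl1 hl2
      obtain ⟨r, c, hr, hc, e1, e2⟩ := ex_box h (show l < d * w by omega)
      rw [e2, ck]
      constructor
      · intro e
        rcases lt_or_ge r x with hrx | hrx
        · have := syt_mono h hx hy (a := r) (b := c) (by omega) (by omega)
          omega
        · have m1 := syt_mono h hr hc (a := x) (b := y+1) (by omega) (by omega)
          have m2 := h'.2.2.1 x y hx (by omega)
          have := hA x (y+1) (by omega)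
          omega
      · intro e
        rcases lt_or_ge c y with hrx | hrx
        · have := syt_mono h hx hy (a := r) (b := c) (by omega) (by omega)
          omega
        · have m1 := syt_mono h hr hc (a := x+1) (b := y) (by omega) (by omega)
          have m2 := h'.2.2.2.1 x y (by omega) hy
          have := hA (x+1) y (by omega)
          omega
    obtain ⟨P, rfl⟩ : ∃ P, M = P + 1 := ⟨M - 1, by omega⟩
    have h1 : IsSYT d w (cyE k (P+1) E) := cyE_syt h (by omega) (by omega) hcorner
    have v1B : cyE k (P+1) E x y = P + 2 := by unfold cyE; rw [if_pos hk]
    have v1A : cyE k (P+1) E a b = P + 1 := by unfold cyE; split_ifs <;> omega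
    have c1B := cont_eq h1 hx hy v1B
    have c1A := cont_eq h1 ha hb v1A
    have cA := cont_eq h ha hb eA
    have hn1 : ¬ (cont d w (cyE k (P+1) E) P - cont d w (cyE k (P+1) E) (P+1) = 1 ∨
        cont d w (cyE k (P+1) E) (P+1) - cont d w (cyE k (P+1) E) P = 1) := by
      have := hcorner (P+1) (by omega) le_rfl
      omega
    have hA1 : Agr (P+1) (cyE k (P+1) E) E' := by
      intro u v huv
      by_cases hc : P + 2 < E u v ∨ P + 2 < E' u v
      · rw [← hA u v hc]
        have := hA u v hc
        unfold cyE; split_ifs <;> omega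
      · rcases huv with huv | huv
        · obtain ⟨hu, hv⟩ := in_rect h1 (show 0 < cyE k (P+1) E u v by omega)
          have : cyE k (P+1) E u v = P + 2 := by
            unfold cyE at huv ⊢
            split_ifs at huv ⊢ <;> omega
          obtain ⟨rfl, rfl⟩ := syt_inj h1 hu hv hx hy (by omega)
          omega
        · obtain ⟨hu, hv⟩ := in_rect h' (show 0 < E' u v by omega)
          obtain ⟨rfl, rfl⟩ := syt_inj h' hu hv hx hy (by omega)
          omega
    refine ih _ E' h1 h' hA1 ?_
    have h2 : IsSYT d w (swE P (cyE k (P+1) E)) := swE_syt h1 (by omega) hn1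
    have hs2 : S (cont d w (swE P (cyE k (P+1) E))) := by
      exact ih E _ h h2 (agr_a k P E (by omega)) hs
    have v2B : swE P (cyE k (P+1) E) x y = P + 1 := by
      unfold swE; rw [v1B]; simp
    have v2A : swE P (cyE k (P+1) E) a b = P + 2 := by
      unfold swE; rw [v1A]; simp
    have c2B := cont_eq h2 hx hy v2B
    have c2A := cont_eq h2 ha hb v2A
    obtain ⟨t, ht, htb, htn⟩ := ex_between (cont_good h2) (P := P) (by omega) (by omega)
    obtain ⟨i, rfl⟩ : ∃ i, P = i + 1 := ⟨P - 1, by omega⟩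
    have h3 := cyE_syt h2 (k := t) (m := i) (by omega) (by omega) (fun l l1 l2 => htn l l1 (by omega))
    obtain ⟨r, c, hr, hc, e1, e2⟩ := ex_box h2 (show t < d * w by omega)
    have v3C : cyE t i (swE (i+1) (cyE k (i+1+1) E)) r c = i + 1 := by
      unfold cyE at *; rw [if_pos e1]
    have v3B : cyE t i (swE (i+1) (cyE k (i+1+1) E)) x y = i + 2 := by
      generalize swE (i+1) (cyE k (i+1+1) E) = F at *
      unfold cyE; split_ifs <;> omega
    have v3A : cyE t i (swE (i+1) (cyE k (i+1+1) E)) a b = i + 3 := by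
      generalize swE (i+1) (cyE k (i+1+1) E) = F at *
      unfold cyE; split_ifs <;> omega
    have c3C := cont_eq h3 hr hc v3C
    have c3B := cont_eq h3 hx hy v3B
    have c3A := cont_eq h3 ha hb v3A
    have hs3 : S (cont d w (cyE t i (swE (i+1) (cyE k (i+1+1) E)))) := by
      exact ih _ _ h2 h3 (agr_b t i _ (by omega)) hs2
    have hn3 : ¬ (cont d w (cyE t i (swE (i+1) (cyE k (i+1+1) E))) (i+1) -
          cont d w (cyE t i (swE (i+1) (cyE k (i+1+1) E))) (i+1+1) = 1 ∨
        cont d w (cyE t i (swE (i+1) (cyE k (i+1+1) E))) (i+1+1) -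
          cont d w (cyE t i (swE (i+1) (cyE k (i+1+1) E))) (i+1) = 1) := by
      have e1 : i + 1 + 1 = i + 2 := rfl
      rw [e1] at *
      omega
    have h4 := swE_syt h3 (by omega) hn3
    have c4 := swE_cont h3 (by omega) hn3
    have hdk : dk i (cont d w (cyE t i (swE (i+1) (cyE k (i+1+1) E)))) =
        cont d w (cyE t i (swE (i+1) (cyE k (i+1+1) E))) ∘ Equiv.swap (i+1) (i+1+1) := by
      have e1 : i + 1 + 1 = i + 2 := rfl
      rw [e1] at *
      unfold dk
      rw [if_neg (by omega), if_pos (by omega)]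
    have hs4 : S (cont d w (swE (i+1) (cyE t i (swE (i+1) (cyE k (i+1+1) E))))) := by
      rw [c4, ← hdk]
      exact hS _ ⟨_, h3, rfl⟩ i (by omega) hs3
    exact ih _ _ h4 h1 (agr_c t i _ (by omega)) hs4

lemma trans_all (S : (ℕ → ℤ) → Prop)
    (hS : ∀ f ∈ VV d w, ∀ i, i + 2 < d * w → S f → S (dk i f)) (f : ℕ → ℤ) (hf : f ∈ VV d w) (hs : S f) :
    ∀ g ∈ VV d w, S g := by
  rintro g ⟨E', h', rfl⟩
  obtain ⟨E, h, rfl⟩ := hf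
  refine trans_ind S hS (d*w) le_rfl E E' h h' ?_ hs
  intro a b hab
  exfalso
  rcases hab with hab | hab
  · obtain ⟨ha, hb⟩ := in_rect h (show 0 < E a b by omega)
    have := h.2.1 a b ha hb
    omega
  · obtain ⟨ha, hb⟩ := in_rect h' (show 0 < E' a b by omega)
    have := h'.2.1 a b ha hb
    omega
end T
end S14

namespace S14

section F
variable {d w : ℕ} {E E' : ℕ → ℕ → ℕ}

/-- the superstandard tableau -/
def E0 (d w : ℕ) : ℕ → ℕ → ℕ := fun a b => if a < d ∧ b < w then a * w + b + 1 else 0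

lemma E0_val {a b : ℕ} (ha : a < d) (hb : b < w) : E0 d w a b = a * w + b + 1 := by
  unfold E0; rw [if_pos ⟨ha, hb⟩]

lemma ex_div (hw : 0 < w) {k : ℕ} (hk : k < d * w) : ∃ a b, a < d ∧ b < w ∧ a * w + b = k := by
  refine ⟨k / w, k % w, ?_, Nat.mod_lt _ hw, Nat.div_add_mod' k w⟩
  exact (Nat.div_lt_iff_lt_mul hw).2 hk

lemma E0_lt {a b : ℕ} (ha : a < d) (hb : b < w) : a * w + b + 1 ≤ d * w := by
  obtain ⟨c, rfl⟩ : ∃ c, d = a + 1 + c := ⟨d - a - 1, by omega⟩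
  have : (a + 1 + c) * w = a * w + w + c * w := by ring
  omega

lemma E0_syt (hw : 0 < w) : IsSYT d w (E0 d w) := by
  refine ⟨?_, ?_, ?_, ?_, ?_⟩
  · intro a b hab
    unfold E0; rw [if_neg (by omega)]
  · intro a b ha hb
    rw [E0_val ha hb]
    have := E0_lt ha hb
    omega
  · intro a b ha hb
    rw [E0_val ha hb, E0_val ha (by omega)]
    omega
  · intro a b ha hb
    rw [E0_val ha hb, E0_val (by omega) hb, show (a+1) * w = a * w + w by ring]
    omega
  · intro m h1 h2
    obtain ⟨a, b, ha, hb, e⟩ := ex_div hw (show m - 1 < d * w by omega)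
    exact ⟨a, b, ha, hb, by rw [E0_val ha hb]; omega⟩

lemma rot_E0 (hw : 0 < w) : rotF (d*w) ((w:ℤ) - d) (cont d w (E0 d w)) = cont d w (E0 d w) := by
  have h := E0_syt (d := d) hw
  funext k
  unfold rotF
  split_ifs with hk
  · obtain ⟨a, b, ha, hb, e⟩ := ex_div hw hk
    have h1 := cont_eq h ha hb (k := k) (by rw [E0_val ha hb, e])
    have h2 := cont_eq h (a := d-1-a) (b := w-1-b) (k := d*w-1-k) (by omega) (by omega) (by
      rw [E0_val (by omega) (by omega)]
      obtain ⟨c, rfl⟩ : ∃ c, d = a + 1 + c := ⟨d - a - 1, by omega⟩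
      have e1 : (a + 1 + c) * w = a * w + w + c * w := by ring
      have e2 : a + 1 + c - 1 - a = c := by omega
      rw [e2]
      omega)
    rw [h1, h2]
    omega
  · rfl

lemma E0_unique (hw : 0 < w) (h : IsSYT d w E)
    (hdes : ∀ k, k + 1 < d * w → cont d w E (k+1) < cont d w E k →
      cont d w (E0 d w) (k+1) < cont d w (E0 d w) k) : E = E0 d w := by
  have h0 := E0_syt (d := d) hw
  have claim : ∀ k, k ≤ d * w → ∀ a b, a < d → b < w → (E a b ≤ k ∨ a * w + b < k) →
      E a b = a * w + b + 1 := by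
    intro k
    induction k with
    | zero =>
      intro _ a b ha hb hab
      have := h.2.1 a b ha hb
      omega
    | succ k ih =>
      intro hk
      have ih := ih (by omega)
      obtain ⟨a, b, ha, hb, e1, e2⟩ := ex_box h (show k < d * w by omega)
      have hmain : a * w + b = k := by
        have hge : k ≤ a * w + b := by
          by_contra hc
          have := ih a b ha hb (by omega)
          omega
        rcases b with _ | b
        · rcases a with _ | a
          · omega
          · have m1 := syt_mono h ha hb (a := a) (b := 0) (by omega) (by omega)
            have m2 := ih a 0 (by omega) hb (by omega)
            have e3 : (a+1) * w = a * w + w := by ring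
            by_contra hne
            obtain ⟨r, hr⟩ : ∃ r, k = a * w + r + 1 := ⟨k - a * w - 1, by omega⟩
            have m3 := ih a r (by omega) (by omega) (by omega)
            have c1 := cont_eq h (a := a) (b := r) (k := k-1) (by omega) (by omega) (by omega)
            have c2 := cont_eq h0 (a := a) (b := r) (k := k-1) (by omega) (by omega)
              (by rw [E0_val (by omega) (by omega)]; omega)
            have c3 := cont_eq h0 (a := a) (b := r+1) (k := k) (by omega) (by omega)
              (by rw [E0_val (by omega) (by omega)]; omega)
            have c4 := hdes (k-1) (by omega)
            rw [show k - 1 + 1 = k by omega, e2, c1, c2, c3] at c4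
            push_cast at c4
            omega
        · have m1 := h.2.2.1 a b ha hb
          have m2 := ih a b ha (by omega) (by omega)
          omega
      intro a' b' ha' hb' hab
      rcases hab with hab | hab
      · rcases Nat.eq_or_lt_of_le hab with he | he
        · obtain ⟨rfl, rfl⟩ := syt_inj h ha' hb' ha hb (by omega)
          omega
        · exact ih a' b' ha' hb' (by omega)
      · rcases Nat.eq_or_lt_of_le (Nat.le_of_lt_succ hab) with he | he
        · obtain ⟨rfl, rfl⟩ := syt_inj h0 ha' hb' ha hb (by
            rw [E0_val ha' hb', E0_val ha hb]; omega)
          omega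
        · exact ih a' b' ha' hb' (by omega)
  funext a b
  by_cases hab : a < d ∧ b < w
  · rw [E0_val hab.1 hab.2]
    exact claim (d*w) le_rfl a b hab.1 hab.2 (Or.inl (h.2.1 a b hab.1 hab.2).2)
  · rw [h.1 a b (by omega), h0.1 a b (by omega)]

lemma Ev_E0 (hd : 0 < d) (hw : 0 < w) : Ev (d*w-1) (cont d w (E0 d w)) = cont d w (E0 d w) := by
  have hN : 0 < d * w := Nat.mul_pos hd hw
  have h0 := E0_syt (d := d) hw
  have hm : cont d w (E0 d w) ∈ VV d w := ⟨_, h0, rfl⟩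
  obtain ⟨E, h, e⟩ := Ev_mem VV_cl (d*w-1) (by omega) _ hm
  have hE : E = E0 d w := by
    refine E0_unique hw h ?_
    intro k hk hdes
    rw [e] at hdes
    have hD := Ev_desc (N := d*w) VV_good VV_cl (d*w-1) (by omega) (d*w-2-k) (by omega) _ hm
    rw [show d*w-1-1-(d*w-2-k) = k by omega] at hD
    have hD := hD.1 hdes
    have r := rot_E0 (d := d) hw
    have r1 := congrFun r k
    have r2 := congrFun r (k+1)
    unfold rotF at r1 r2
    rw [if_pos (by omega)] at r1 r2
    rw [show d*w-2-k+1 = d*w-1-k by omega, show d*w-2-k = d*w-1-(k+1) by omega] at hD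
    omega
  rw [← e, hE]

lemma Ev_eq_rot (hd : 0 < d) (hw : 0 < w) :
    ∀ f ∈ VV d w, Ev (d*w-1) f = rotF (d*w) ((w:ℤ) - d) f := by
  have hN : 0 < d * w := Nat.mul_pos hd hw
  refine trans_all (fun f => Ev (d*w-1) f = rotF (d*w) ((w:ℤ) - d) f) ?_ (cont d w (E0 d w))
    ⟨_, E0_syt hw, rfl⟩ ?_
  · intro f hf i hi hs
    rw [Ev_dk (N := d*w) VV_good VV_cl (d*w-1) (by omega) i (by omega) f hf, rot_dk _ _ _ (by omega), hs,
      show d*w-1-2-i = d*w-3-i by omega]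
  · rw [Ev_E0 hd hw, rot_E0 hw]

lemma fix_iff (hd : 0 < d) (hw : 0 < w) {ℓ : ℕ} (hl : 2 * ℓ = d * w) (f : ℕ → ℤ) (hf : f ∈ VV d w) :
    (J (d*w-1) ^ ℓ) f = f ↔
      Ev (d*w-1) (Ev (ℓ-1) (Ev (d*w-1) f)) = Ev (ℓ-1) (Ev (d*w-1) f) := by
  have hN : 0 < d * w := Nat.mul_pos hd hw
  have hR := Ev_eq_rot hd hw
  have hE1 : Ev (d*w-1) f ∈ VV d w := Ev_mem VV_cl (d*w-1) (by omega) f hf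
  have hE2 : Ev (ℓ-1) (Ev (d*w-1) f) ∈ VV d w := Ev_mem VV_cl (ℓ-1) (by omega) _ hE1
  have sq : ∀ k g, Ev k (Ev k g) = g := fun k g =>
    congrArg (fun p : Equiv.Perm (ℕ → ℤ) => p g) (Ev_sq k)
  have hp := J_pow (d*w) ((w:ℤ) - d) (ℓ-1) (by omega)
  rw [show ℓ - 1 + 1 = ℓ by omega, show d*w-2-(ℓ-1) = ℓ-1 by omega] at hp
  have hp2 := congrArg (fun p : Equiv.Perm (ℕ → ℤ) => p (Ev (d*w-1) f)) hp
  have hp3 : (J (d*w-1) ^ ℓ) (Ev (d*w-1) (Ev (d*w-1) f)) =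
      rotF (d*w) ((w:ℤ)-d) (Ev (ℓ-1) (rotF (d*w) ((w:ℤ)-d) (Ev (ℓ-1) (Ev (d*w-1) f)))) := hp2
  rw [sq] at hp3
  rw [hp3, hR _ hE2]
  constructor
  · intro h
    have h1 := congrArg (rotF (d*w) ((w:ℤ)-d)) h
    rw [rotF_rotF, ← hR f hf] at h1
    have h2 := congrArg (Ev (ℓ-1)) h1
    rwa [sq] at h2
  · intro h
    rw [h, sq, hR f hf, rotF_rotF]

theorem main (hd : 0 < d) (hw : 0 < w) {ℓ : ℕ} (hl : 2 * ℓ = d * w) :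
    Set.ncard {E : ℕ → ℕ → ℕ | IsSYT d w E ∧ evac d w E = E} =
      Set.ncard {E : ℕ → ℕ → ℕ | IsSYT d w E ∧ (promo d w)^[ℓ] E = E} := by
  have hN : 0 < d * w := Nat.mul_pos hd hw
  have sq : ∀ k g, Ev k (Ev k g) = g := fun k g =>
    congrArg (fun p : Equiv.Perm (ℕ → ℤ) => p g) (Ev_sq k)
  have i1 : cont d w '' {E : ℕ → ℕ → ℕ | IsSYT d w E ∧ evac d w E = E} =
      {f | f ∈ VV d w ∧ Ev (d*w-1) f = f} := by
    ext f
    constructor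
    · rintro ⟨E, ⟨h, e⟩, rfl⟩
      refine ⟨⟨E, h, rfl⟩, ?_⟩
      rw [← (evac_cont h hd hw).2, e]
    · rintro ⟨⟨E, h, rfl⟩, e⟩
      refine ⟨E, ⟨h, ?_⟩, rfl⟩
      obtain ⟨a1, a2⟩ := evac_cont h hd hw
      exact cont_inj a1 h (by rw [a2, e])
  have i2 : cont d w '' {E : ℕ → ℕ → ℕ | IsSYT d w E ∧ (promo d w)^[ℓ] E = E} =
      {f | f ∈ VV d w ∧ (J (d*w-1) ^ ℓ) f = f} := by
    ext f
    constructor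
    · rintro ⟨E, ⟨h, e⟩, rfl⟩
      refine ⟨⟨E, h, rfl⟩, ?_⟩
      rw [← (promo_iter h hd hw ℓ).2, e]
    · rintro ⟨⟨E, h, rfl⟩, e⟩
      refine ⟨E, ⟨h, ?_⟩, rfl⟩
      obtain ⟨a1, a2⟩ := promo_iter h hd hw ℓ
      exact cont_inj a1 h (by rw [a2, e])
  have i3 : (fun f => Ev (ℓ-1) (Ev (d*w-1) f)) '' {f | f ∈ VV d w ∧ (J (d*w-1) ^ ℓ) f = f} =
      {f | f ∈ VV d w ∧ Ev (d*w-1) f = f} := by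
    ext g
    constructor
    · rintro ⟨f, ⟨hf, e⟩, rfl⟩
      exact ⟨Ev_mem VV_cl (ℓ-1) (by omega) _ (Ev_mem VV_cl (d*w-1) (by omega) f hf),
        (fix_iff hd hw hl f hf).1 e⟩
    · rintro ⟨hg, e⟩
      have hf : Ev (d*w-1) (Ev (ℓ-1) g) ∈ VV d w :=
        Ev_mem VV_cl (d*w-1) (by omega) _ (Ev_mem VV_cl (ℓ-1) (by omega) g hg)
      refine ⟨_, ⟨hf, ?_⟩, ?_⟩
      · rw [fix_iff hd hw hl _ hf, sq, sq, e]
      · simp only [sq]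
  have j1 := Set.ncard_image_of_injOn (f := cont d w)
    (s := {E : ℕ → ℕ → ℕ | IsSYT d w E ∧ evac d w E = E})
    (fun E h E' h' e => cont_inj h.1 h'.1 e)
  have j2 := Set.ncard_image_of_injOn (f := cont d w)
    (s := {E : ℕ → ℕ → ℕ | IsSYT d w E ∧ (promo d w)^[ℓ] E = E})
    (fun E h E' h' e => cont_inj h.1 h'.1 e)
  have j3 := Set.ncard_image_of_injective {f | f ∈ VV d w ∧ (J (d*w-1) ^ ℓ) f = f}
    (f := fun f => Ev (ℓ-1) (Ev (d*w-1) f))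
    ((Ev (ℓ-1)).injective.comp (Ev (d*w-1)).injective)
  rw [← j1, ← j2, i1, i2, ← i3, j3]
end F
end S14


/-- Suppose `N = d(n-d)` is even (`N = 2ℓ`).  The number of
standard Young tableaux of rectangular shape `(n-d)^d` fixed by evacuation `𝑒`
equals the number of standard Young tableaux of shape `(n-d)^d` fixed by
`𝑗^{N/2}`. -/
theorem statement14 (d n ℓ : ℕ) (hd : 0 < d) (hdn : d < n)
    (hl : 2 * ℓ = d * (n - d)) :
    Set.ncard {E : ℕ → ℕ → ℕ | IsSYT d (n - d) E ∧ evac d (n - d) E = E} =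
      Set.ncard {E : ℕ → ℕ → ℕ |
        IsSYT d (n - d) E ∧ (promo d (n - d))^[ℓ] E = E} := by
  exact S14.main hd (by omega) hl
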